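/- Let a be a natural number and let (Y, S) be a dynamical system. For any equivariant continuous map π : (([0,1]^a)^ℤ, σ) → (Y, S), the lower conditional metric mean dimension satisfies lower-mdim_M(π, σ, D) ≥ a − 2·mdim(Y, S), where D is the metric D((x_n), (y_n)) = Σ_{n∈ℤ} 2^{-|n|} ‖x_n − y_n‖_∞ on ([0,1]^a)^ℤ and mdim(Y, S) is the mean dimension of (Y, S). -/

import Mathlib

open Filter Topology
open scoped ENNReal NNReal

noncomputable section

/-- Diameter (in `ℝ≥0∞`) of a set with respect to a distance function `ρ`. -/
def setEDiam {X : Type*} (ρ : X → X → ℝ) (E : Set X) : ℝ≥0∞ :=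
  ⨆ x ∈ E, ⨆ y ∈ E, ENNReal.ofReal (ρ x y)

/-- Openness with respect to a distance function `ρ`. -/
def ROpen {X : Type*} (ρ : X → X → ℝ) (U : Set X) : Prop :=
  ∀ x ∈ U, ∃ δ > 0, ∀ y, ρ x y < δ → y ∈ U

/-- `#(E, ρ, ε)`: the minimal number `n` of `ρ`-open sets of `ρ`-diameter `< ε` covering `E`
(`0` when `E = ∅`, since the empty family covers it). -/
def covNum {X : Type*} (ρ : X → X → ℝ) (ε : ℝ) (E : Set X) : ℕ :=
  sInf {n : ℕ | ∃ U : Fin n → Set X, (∀ i, ROpen ρ (U i)) ∧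
    (∀ i, setEDiam ρ (U i) < ENNReal.ofReal ε) ∧ E ⊆ ⋃ i, U i}

/-- The dynamical metric `d_N(x,y) = max_{0 ≤ n < N} d(Tⁿx, Tⁿy)`. -/
def dynDist {X : Type*} (T : X → X) (d : X → X → ℝ) (N : ℕ) (x y : X) : ℝ :=
  sSup {r : ℝ | ∃ n, n < N ∧ r = d (T^[n] x) (T^[n] y)}

/-- `sup_{y ∈ Y} log #(π⁻¹(y), ρ, ε)`. -/
def supLogCov {X Y : Type*} (π : X → Y) (ρ : X → X → ℝ) (ε : ℝ) : ℝ :=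
  ⨆ y : Y, Real.log (covNum ρ ε (π ⁻¹' {y}) : ℝ)

/-- `sup_{y ∈ Y} log #(π⁻¹(B_δ(y, ρY)), ρX, ε)` where `B_δ` is the closed `δ`-ball. -/
def supLogCovBall {X Y : Type*} (π : X → Y) (ρX : X → X → ℝ) (ρY : Y → Y → ℝ)
    (ε δ : ℝ) : ℝ :=
  ⨆ y : Y, Real.log (covNum ρX ε (π ⁻¹' {x | ρY x y ≤ δ}) : ℝ)

/-- Topological conditional entropy
`h_top(π, T) = lim_{ε→0} lim_{N→∞} (sup_y log #(π⁻¹(y), d_N, ε))/N`, as an extended real. -/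
def condEntropy {X Y : Type*} (π : X → Y) (T : X → X) (d : X → X → ℝ) : EReal :=
  Filter.limsup (fun ε : ℝ => Filter.liminf
      (fun N : ℕ => ((supLogCov π (dynDist T d N) ε / N : ℝ) : EReal)) Filter.atTop)
    (𝓝[>] (0 : ℝ))

/-- `lim_{N→∞} (sup_y log #(π⁻¹(y), d_N, ε))/(N log(1/ε))` (the limit exists by
subadditivity; it is realized here as a liminf). -/
def condMdimRate {X Y : Type*} (π : X → Y) (T : X → X) (d : X → X → ℝ) (ε : ℝ) : EReal :=
  Filter.liminf (fun N : ℕ =>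
    ((supLogCov π (dynDist T d N) ε / (N * Real.log (1 / ε)) : ℝ) : EReal)) Filter.atTop

/-- Lower conditional metric mean dimension of `π : (X,T,d) → Y`. -/
def lowerCondMdimM {X Y : Type*} (π : X → Y) (T : X → X) (d : X → X → ℝ) : EReal :=
  Filter.liminf (fun ε : ℝ => condMdimRate π T d ε) (𝓝[>] (0 : ℝ))

/-- Upper conditional metric mean dimension of `π : (X,T,d) → Y`. -/
def upperCondMdimM {X Y : Type*} (π : X → Y) (T : X → X) (d : X → X → ℝ) : EReal :=
  Filter.limsup (fun ε : ℝ => condMdimRate π T d ε) (𝓝[>] (0 : ℝ))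

/-- `lim_{N→∞} log #(X, d_N, ε)/(N log(1/ε))`. -/
def mdimMRate {X : Type*} (T : X → X) (d : X → X → ℝ) (ε : ℝ) : EReal :=
  Filter.liminf (fun N : ℕ =>
    ((Real.log (covNum (dynDist T d N) ε (Set.univ : Set X) : ℝ) /
      (N * Real.log (1 / ε)) : ℝ) : EReal)) Filter.atTop

/-- Lower metric mean dimension of `(X, T, d)`. -/
def lowerMdimM {X : Type*} (T : X → X) (d : X → X → ℝ) : EReal :=
  Filter.liminf (fun ε : ℝ => mdimMRate T d ε) (𝓝[>] (0 : ℝ))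

/-- Upper metric mean dimension of `(X, T, d)`. -/
def upperMdimM {X : Type*} (T : X → X) (d : X → X → ℝ) : EReal :=
  Filter.limsup (fun ε : ℝ => mdimMRate T d ε) (𝓝[>] (0 : ℝ))

/-- `widim_ε(X, ρ)`: the minimal `k` such that there are a finite simplicial complex of
dimension `≤ k` (realized in some `ℝ^m`) and a continuous `ε`-embedding `f : X → P`
(all fibers of `f` have `ρ`-diameter `< ε`). -/
def widim (X : Type*) [TopologicalSpace X] (ρ : X → X → ℝ) (ε : ℝ) : ℕ :=
  sInf {k : ℕ | ∃ (m : ℕ) (K : Geometry.SimplicialComplex ℝ (Fin m → ℝ)),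
    K.faces.Finite ∧ (∀ s ∈ K.faces, s.card ≤ k + 1) ∧
    ∃ f : X → K.space, Continuous f ∧
      ∀ p : K.space, setEDiam ρ (f ⁻¹' {p}) < ENNReal.ofReal ε}

/-- Mean dimension `mdim(X, T) = lim_{ε→0} lim_{N→∞} widim_ε(X, d_N)/N`. -/
def mdim (X : Type*) [TopologicalSpace X] (T : X → X) (d : X → X → ℝ) : EReal :=
  Filter.limsup (fun ε : ℝ => Filter.liminf
      (fun N : ℕ => (((widim X (dynDist T d N) ε : ℝ) / N : ℝ) : EReal)) Filter.atTop)
    (𝓝[>] (0 : ℝ))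

/-- The cube `[0,1]^a`. -/
abbrev Cube (a : ℕ) := Fin a → unitInterval

/-- The full shift space `([0,1]^a)^ℤ`. -/
abbrev FullShift (a : ℕ) := ℤ → Cube a

/-- The shift map `σ((x_n)_n) = (x_{n+1})_n`. -/
def shift {α : Type*} (x : ℤ → α) : ℤ → α := fun n => x (n + 1)

/-- The `ℓ^∞`-distance on the cube `[0,1]^a`. -/
def cubeDist {a : ℕ} (x y : Cube a) : ℝ :=
  ‖(fun i => (x i : ℝ)) - fun i => (y i : ℝ)‖

/-- The metric `D((x_n), (y_n)) = Σ_{n∈ℤ} 2^{-|n|} ‖x_n − y_n‖_∞` on the full shift. -/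
def shiftDist {a : ℕ} (x y : FullShift a) : ℝ :=
  ∑' n : ℤ, (2 : ℝ) ^ (-|n|) * cubeDist (x n) (y n)

end

section Cup

variable {V : Type*}

/-- The cup product of the coboundaries of `s 0, …, s (n-1)` evaluated on a sequence. -/
def cupProd (n : ℕ) (s : ℕ → V → ZMod 2) (w : ℕ → V) : ZMod 2 :=
  ∏ l ∈ Finset.range n, (s l (w l) + s l (w (l + 1)))

/-- The `j`-th face of a sequence. -/
def dropAt (j : ℕ) (v : ℕ → V) : ℕ → V := fun l => if l < j then v l else v (l + 1)

lemma dropAt_zero (v : ℕ → V) : dropAt 0 v = fun l => v (l + 1) := by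
  funext l; simp [dropAt]

lemma dropAt_succ_tail (j : ℕ) (v : ℕ → V) :
    (fun l => dropAt (j + 1) v (l + 1)) = dropAt j (fun l => v (l + 1)) := by
  funext l; simp [dropAt]

lemma dropAt_succ_zero (j : ℕ) (v : ℕ → V) : dropAt (j + 1) v 0 = v 0 := by
  simp [dropAt]

lemma cupProd_succ (n : ℕ) (s : ℕ → V → ZMod 2) (w : ℕ → V) :
    cupProd (n + 1) s w =
      (s 0 (w 0) + s 0 (w 1)) * cupProd n (fun l => s (l + 1)) (fun l => w (l + 1)) := by
  rw [cupProd, Finset.prod_range_succ', mul_comm]; rfl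

lemma zmod_two_add_self (x : ZMod 2) : x + x = 0 := CharTwo.add_self_eq_zero x

lemma sum_mul_dropAt (n : ℕ) (s : V → ZMod 2) (F : (ℕ → V) → ZMod 2) (v : ℕ → V) :
    ∑ j ∈ Finset.range (n + 2), (s (dropAt j v 0) + s (dropAt j v 1)) *
        F (fun l => dropAt j v (l + 1)) =
      (s (v 0) + s (v 1)) * ∑ j ∈ Finset.range (n + 1), F (dropAt j (fun l => v (l + 1))) := by
  rw [Finset.sum_range_succ', Finset.sum_range_succ', Finset.sum_range_succ' _ n, mul_add,
    Finset.mul_sum]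
  simp only [dropAt_succ_tail, dropAt_succ_zero, zero_add]
  have h1 : ∀ j, dropAt (j + 1 + 1) v 1 = v 1 := fun j => by simp [dropAt]
  have h2 : dropAt 1 v 1 = v 2 := by simp [dropAt]
  have h3 : dropAt 0 v 0 = v 1 := by simp [dropAt]
  have h4 : dropAt 0 v 1 = v 2 := by simp [dropAt]
  have h5 : (fun l => dropAt 0 v (l + 1)) = dropAt 0 (fun l => v (l + 1)) := by
    funext l; simp [dropAt]
  simp only [h1, h2, h3, h4, h5]
  have := zmod_two_add_self (s (v 2) * F (dropAt 0 fun l => v (l + 1)))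
  linear_combination this

lemma sum_cupProd_dropAt (n : ℕ) (s : ℕ → V → ZMod 2) (v : ℕ → V) :
    ∑ j ∈ Finset.range (n + 2), cupProd n s (dropAt j v) = 0 := by
  induction n generalizing s v with
  | zero => simp [cupProd]; decide
  | succ n ih =>
    simp only [cupProd_succ]
    rw [sum_mul_dropAt (n + 1) (s 0) (cupProd n fun l => s (l + 1)), ih, mul_zero]

/-- The product `δs₀ ∪ … ∪ δs_{k-1} ∪ h ∪ δs_{k+1} ∪ … ∪ δs_{k+n}`. -/
def cupInsert (k n : ℕ) (s : ℕ → V → ZMod 2) (h : V → ZMod 2) (w : ℕ → V) : ZMod 2 :=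
  cupProd k s w * (h (w k) * cupProd n (fun l => s (l + (k + 1))) (fun l => w (l + k)))

lemma sum_cupInsert_dropAt (k n : ℕ) (s : ℕ → V → ZMod 2) (h : V → ZMod 2) (v : ℕ → V) :
    ∑ j ∈ Finset.range (k + n + 2), cupInsert k n s h (dropAt j v) =
      cupProd k s v * ((h (v k) + h (v (k + 1))) *
        cupProd n (fun l => s (l + (k + 1))) (fun l => v (l + (k + 1)))) := by
  induction k generalizing s v with
  | zero =>
    have := sum_cupProd_dropAt n (fun l => s (l + 1)) v
    rw [Finset.sum_range_succ', dropAt_zero] at this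
    rw [zero_add, Finset.sum_range_succ']
    simp only [cupInsert, dropAt_succ_zero, add_zero, zero_add, cupProd.eq_1 0,
      Finset.range_zero, Finset.prod_empty, one_mul, ← Finset.mul_sum, dropAt_zero]
    have e : ∀ j, (fun l => dropAt (j + 1) v l) = dropAt (j + 1) v := fun j => rfl
    simp only [e]
    linear_combination h (v 0) * this -
      zmod_two_add_self (h (v 0) * (cupProd n (fun l => s (l + 1)) fun l => v (l + 1)))
  | succ k ih =>
    have e : ∀ w : ℕ → V, cupInsert (k + 1) n s h w =
        (s 0 (w 0) + s 0 (w 1)) * cupInsert k n (fun l => s (l + 1)) h (fun l => w (l + 1)) := by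
      intro w
      simp only [cupInsert, cupProd_succ, mul_assoc]
      rfl
    simp only [e]
    have := sum_mul_dropAt (k + n + 1) (s 0) (cupInsert k n (fun l => s (l + 1)) h) v
    rw [show k + 1 + n + 2 = k + n + 1 + 2 by ring, this, ih, cupProd_succ]
    simp only [mul_assoc]
    rfl

lemma cupProd_split (k n : ℕ) (s : ℕ → V → ZMod 2) (v : ℕ → V) :
    cupProd (k + 1 + n) s v = cupProd k s v * ((s k (v k) + s k (v (k + 1))) *
        cupProd n (fun l => s (l + (k + 1))) (fun l => v (l + (k + 1)))) := by
  rw [cupProd, Finset.prod_range_add, Finset.prod_range_succ, mul_assoc, cupProd, cupProd]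
  congr 2
  refine Finset.prod_congr rfl fun l _ => ?_
  rw [add_comm (k + 1) l, show l + (k + 1) + 1 = l + 1 + (k + 1) by ring]

lemma cupProd_congr {n : ℕ} {s s' : ℕ → V → ZMod 2} {v v' : ℕ → V} (hs : ∀ l < n, s l = s' l)
    (hv : ∀ l ≤ n, v l = v' l) : cupProd n s v = cupProd n s' v' := by
  refine Finset.prod_congr rfl fun l hl => ?_
  have := Finset.mem_range.1 hl
  rw [hs l this, hv l this.le, hv (l + 1) this]

end Cup

section Lattice

open Finset

/-- A vertex assigns to every slot and type a position and a sign. -/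
abbrev SVertex (m a : ℕ) := Fin m → Fin a → ℕ × ZMod 2

variable {m a N : ℕ}

/-- Number of letters of type `i` located in slots before `t`, or in slot `t` at a place
`≥ l` of the word. -/
def posCount (u : Fin N → Fin m × Fin a) (l : ℕ) (t : Fin m) (i : Fin a) : ℕ :=
  ∑ k : Fin N, if (u k).2 = i ∧ ((u k).1 < t ∨ ((u k).1 = t ∧ l ≤ k)) then 1 else 0

/-- The sign at position `p` on the `i`-th path. -/
def signAt {d : Fin a → ℕ} (e : (i : Fin a) → Fin (d i) → ZMod 2) (i : Fin a) (p : ℕ) : ZMod 2 :=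
  if h : 1 ≤ p ∧ p - 1 < d i then e i ⟨p - 1, h.2⟩ else 0

/-- The `l`-th vertex of the simplex of a word with signs. -/
def wordVertex {d : Fin a → ℕ} (u : Fin N → Fin m × Fin a)
    (e : (i : Fin a) → Fin (d i) → ZMod 2) (l : ℕ) : SVertex m a :=
  fun t i => (posCount u l t i, signAt e i (posCount u l t i))

/-- Changing signs by a group element. -/
def signShift (g : Fin a → ZMod 2) (w : SVertex m a) : SVertex m a :=
  fun t i => ((w t i).1, (w t i).2 + g i)

/-- The words containing exactly `d i` letters of type `i`. -/
def words (m N : ℕ) (d : Fin a → ℕ) : Finset (Fin N → Fin m × Fin a) :=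
  univ.filter fun u => ∀ i, (∑ k : Fin N, if (u k).2 = i then 1 else 0) = d i

lemma mem_words {d : Fin a → ℕ} {u : Fin N → Fin m × Fin a} :
    u ∈ words m N d ↔ ∀ i, (∑ k : Fin N, if (u k).2 = i then 1 else 0) = d i := by
  simp [words]

lemma posCount_comp_swap (u : Fin N → Fin m × Fin a) {j : ℕ} (hj : j + 1 < N) {l : ℕ}
    (hl : l ≠ j + 1) (t : Fin m) (i : Fin a) :
    posCount (u ∘ Equiv.swap ⟨j, by omega⟩ ⟨j + 1, hj⟩) l t i = posCount u l t i := by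
  unfold posCount
  rw [← Equiv.sum_comp (Equiv.swap (⟨j, by omega⟩ : Fin N) ⟨j + 1, hj⟩)]
  refine sum_congr rfl fun k _ => ?_
  have : l ≤ (Equiv.swap (⟨j, by omega⟩ : Fin N) ⟨j + 1, hj⟩ k : ℕ) ↔ l ≤ k := by
    rcases eq_or_ne k ⟨j, by omega⟩ with rfl | h1
    · simp; omega
    rcases eq_or_ne k ⟨j + 1, hj⟩ with rfl | h2
    · simp; omega
    rw [Equiv.swap_apply_of_ne_of_ne h1 h2]
  simp [this]

lemma comp_swap_mem_words {d : Fin a → ℕ} {u : Fin N → Fin m × Fin a} (hu : u ∈ words m N d)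
    (p q : Fin N) : u ∘ Equiv.swap p q ∈ words m N d := by
  rw [mem_words] at hu ⊢
  intro i
  rw [← hu i]
  exact Equiv.sum_comp (Equiv.swap p q) fun k => if (u k).2 = i then 1 else 0

lemma posCount_le {d : Fin a → ℕ} {u : Fin N → Fin m × Fin a} (hu : u ∈ words m N d)
    (l : ℕ) (t : Fin m) (i : Fin a) : posCount u l t i ≤ d i := by
  rw [← mem_words.1 hu i]
  refine sum_le_sum fun k _ => ?_
  split_ifs <;> simp_all

/-- Flip the sign at position `p` of path `i`. -/
def flipSign {d : Fin a → ℕ} (i : Fin a) (p : ℕ) (e : (i : Fin a) → Fin (d i) → ZMod 2) :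
    (i : Fin a) → Fin (d i) → ZMod 2 :=
  fun i' q => e i' q + if i' = i ∧ (q : ℕ) + 1 = p then 1 else 0

lemma flipSign_flipSign {d : Fin a → ℕ} (i : Fin a) (p : ℕ)
    (e : (i : Fin a) → Fin (d i) → ZMod 2) : flipSign i p (flipSign i p e) = e := by
  funext i' q
  simp only [flipSign, add_assoc, CharTwo.add_self_eq_zero, add_zero]

lemma flipSign_ne {d : Fin a → ℕ} (i : Fin a) {p : ℕ} (hp : 1 ≤ p) (hpd : p ≤ d i)
    (e : (i : Fin a) → Fin (d i) → ZMod 2) : flipSign i p e ≠ e := by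
  intro h
  have := congrFun (congrFun h i) ⟨p - 1, by omega⟩
  simp [flipSign, Nat.sub_add_cancel hp] at this

lemma signAt_flipSign {d : Fin a → ℕ} (i : Fin a) (p : ℕ)
    (e : (i : Fin a) → Fin (d i) → ZMod 2) (i' : Fin a) (q : ℕ) (h : i' = i → q ≠ p) :
    signAt (flipSign i p e) i' q = signAt e i' q := by
  unfold signAt flipSign
  by_cases h1 : 1 ≤ q ∧ q - 1 < d i'
  · have : ¬ (i' = i ∧ q - 1 + 1 = p) := fun ⟨h2, h3⟩ => h h2 (by omega)
    rw [dif_pos h1, dif_pos h1, if_neg this, add_zero]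
  · rw [dif_neg h1, dif_neg h1]

lemma wordVertex_flipSign {d : Fin a → ℕ} (u : Fin N → Fin m × Fin a)
    (e : (i : Fin a) → Fin (d i) → ZMod 2) (i : Fin a) (p l : ℕ)
    (h : ∀ t, posCount u l t i ≠ p) : wordVertex u (flipSign i p e) l = wordVertex u e l := by
  funext t i'
  simp only [wordVertex]
  rw [signAt_flipSign]
  rintro rfl
  exact h t

/-- Equal consecutive letters: the position at the intermediate vertex occurs nowhere else. -/
lemma posCount_ne {u : Fin N → Fin m × Fin a} {j : ℕ} (hj : j + 1 < N) {t : Fin m} {i : Fin a}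
    (h0 : u ⟨j, by omega⟩ = (t, i)) (h1 : u ⟨j + 1, hj⟩ = (t, i)) {l : ℕ} (hl : l ≠ j + 1)
    (t' : Fin m) : posCount u l t' i ≠ posCount u (j + 1) t i := by
  have key : (∃ k : Fin N, k.1 = j ∧ True) := ⟨⟨j, by omega⟩, rfl, trivial⟩
  by_cases hc : t < t' ∨ (t = t' ∧ l < j + 1)
  · apply ne_of_gt
    refine sum_lt_sum (fun k _ => ?_) ⟨⟨j, by omega⟩, mem_univ _, ?_⟩
    · split_ifs with h2 h3
      · exact le_rfl
      · exfalso; apply h3; refine ⟨h2.1, ?_⟩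
        rcases h2.2 with h4 | ⟨h4, h5⟩
        · rcases hc with h | ⟨h, _⟩
          · exact Or.inl (h4.trans h)
          · exact Or.inl (h ▸ h4)
        · rcases hc with h | ⟨h, h'⟩
          · exact Or.inl (h4 ▸ h)
          · exact Or.inr ⟨h4.trans h, by omega⟩
      · exact zero_le_one
      · exact le_rfl
    · rw [if_neg, if_pos]
      · simp
      · refine ⟨by rw [h0], ?_⟩
        rw [h0]
        rcases hc with h | ⟨h, h'⟩
        · exact Or.inl h
        · exact Or.inr ⟨h, by simp; omega⟩
      · rw [h0]; simp
  · apply ne_of_lt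
    have hc' : t' < t ∨ (t' = t ∧ j + 1 < l) := by
      rcases lt_trichotomy t t' with h | h | h
      · exact absurd (Or.inl h) hc
      · right; refine ⟨h.symm, ?_⟩
        by_contra h'; exact hc (Or.inr ⟨h, by omega⟩)
      · exact Or.inl h
    refine sum_lt_sum (fun k _ => ?_) ⟨⟨j + 1, hj⟩, mem_univ _, ?_⟩
    · split_ifs with h2 h3
      · exact le_rfl
      · exfalso; apply h3; refine ⟨h2.1, ?_⟩
        rcases h2.2 with h4 | ⟨h4, h5⟩
        · rcases hc' with h | ⟨h, _⟩
          · exact Or.inl (h4.trans h)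
          · exact Or.inl (h ▸ h4)
        · rcases hc' with h | ⟨h, h'⟩
          · exact Or.inl (h4 ▸ h)
          · exact Or.inr ⟨h4.trans h, by omega⟩
      · exact zero_le_one
      · exact le_rfl
    · rw [if_neg, if_pos]
      · simp
      · rw [h1]; simp
      · rw [h1]
        rintro ⟨_, h | ⟨h, h'⟩⟩
        · rcases hc' with h2 | ⟨h2, _⟩
          · exact lt_asymm h h2
          · exact h.ne h2.symm
        · rcases hc' with h2 | ⟨h2, h3⟩
          · exact h2.ne h.symm
          · simp at h'; omega

lemma posCount_mid {d : Fin a → ℕ} {u : Fin N → Fin m × Fin a} (hu : u ∈ words m N d)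
    {j : ℕ} (hj : j + 1 < N) {t : Fin m} {i : Fin a} (h1 : u ⟨j + 1, hj⟩ = (t, i)) :
    1 ≤ posCount u (j + 1) t i ∧ posCount u (j + 1) t i ≤ d i := by
  refine ⟨?_, posCount_le hu _ _ _⟩
  refine le_trans ?_ (single_le_sum (fun k _ => Nat.zero_le _) (mem_univ (⟨j + 1, hj⟩ : Fin N)))
  simp [h1]

open Classical in
lemma sum_dropAt_interior (d : Fin a → ℕ) (ψ : (ℕ → SVertex m a) → ZMod 2) {j : ℕ}
    (hj : j + 1 < N) :
    ∑ x ∈ words m N d ×ˢ (univ : Finset ((i : Fin a) → Fin (d i) → ZMod 2)),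
      ψ (dropAt (j + 1) (wordVertex x.1 x.2)) = 0 := by
  have hdrop : ∀ v v' : ℕ → SVertex m a, (∀ l, l ≠ j + 1 → v l = v' l) →
      dropAt (j + 1) v = dropAt (j + 1) v' := by
    intro v v' h
    funext l
    unfold dropAt
    split_ifs with h1
    · exact h l (by omega)
    · exact h (l + 1) (by omega)
  set p0 : Fin N := ⟨j, by omega⟩
  set p1 : Fin N := ⟨j + 1, hj⟩
  have hp01 : p0 ≠ p1 := by simp [p0, p1]
  let T : (Fin N → Fin m × Fin a) × ((i : Fin a) → Fin (d i) → ZMod 2) →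
      (Fin N → Fin m × Fin a) × ((i : Fin a) → Fin (d i) → ZMod 2) := fun x =>
    if x.1 p0 = x.1 p1 then
      (x.1, flipSign (x.1 p1).2 (posCount x.1 (j + 1) (x.1 p1).1 (x.1 p1).2) x.2)
    else (x.1 ∘ Equiv.swap p0 p1, x.2)
  refine sum_involution (fun x _ => T x) ?_ ?_ ?_ ?_
  · rintro ⟨u, e⟩ hx
    have e1 : dropAt (j + 1) (wordVertex u e) = dropAt (j + 1) (wordVertex (T (u, e)).1 (T (u, e)).2) := by
      apply hdrop
      intro l hl
      simp only [T]
      split_ifs with h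
      · rw [wordVertex_flipSign]
        intro t
        exact posCount_ne hj (h.trans rfl) rfl hl t
      · funext t i
        simp only [wordVertex]
        rw [posCount_comp_swap u hj hl]
    rw [e1]
    exact CharTwo.add_self_eq_zero _
  · rintro ⟨u, e⟩ hx _
    simp only [mem_product, mem_univ, and_true] at hx
    simp only [T]
    split_ifs with h
    · intro h'
      have := posCount_mid hx hj (t := (u p1).1) (i := (u p1).2) rfl
      exact flipSign_ne _ this.1 this.2 e (congrArg Prod.snd h')
    · intro h'
      have := congrFun (congrArg Prod.fst h') p0
      simp at this
      exact h this.symm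
  · rintro ⟨u, e⟩ hx
    simp only [mem_product, mem_univ, and_true] at hx ⊢
    simp only [T]
    split_ifs with h
    · exact hx
    · exact comp_swap_mem_words hx _ _
  · rintro ⟨u, e⟩ hx
    simp only [T]
    by_cases h : u p0 = u p1
    · simp only [h, if_true, flipSign_flipSign]
    · have h' : ¬ (u ∘ Equiv.swap p0 p1) p0 = (u ∘ Equiv.swap p0 p1) p1 := by
        simpa using fun h2 => h h2.symm
      simp only [h, h', if_false]
      refine Prod.ext ?_ rfl
      funext k
      simp

end Lattice

section LatticeParity

open Finset

variable {m a n : ℕ}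

lemma words_type_pos {N : ℕ} {d : Fin a → ℕ} {u : Fin N → Fin m × Fin a} (hu : u ∈ words m N d)
    (k : Fin N) : 1 ≤ d (u k).2 := by
  rw [← mem_words.1 hu]
  refine le_trans ?_ (single_le_sum (fun k _ => Nat.zero_le _) (mem_univ k))
  simp

/-- Flip all signs of path `i`. -/
def flipPath {d : Fin a → ℕ} (i : Fin a) (e : (i : Fin a) → Fin (d i) → ZMod 2) :
    (i : Fin a) → Fin (d i) → ZMod 2 :=
  fun i' q => e i' q + if i' = i then 1 else 0

lemma flipPath_flipPath {d : Fin a → ℕ} (i : Fin a) (e : (i : Fin a) → Fin (d i) → ZMod 2) :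
    flipPath i (flipPath i e) = e := by
  funext i' q
  simp only [flipPath, add_assoc, CharTwo.add_self_eq_zero, add_zero]

lemma flipPath_ne {d : Fin a → ℕ} (i : Fin a) (hd : 1 ≤ d i)
    (e : (i : Fin a) → Fin (d i) → ZMod 2) : flipPath i e ≠ e := by
  intro h
  have := congrFun (congrFun h i) ⟨0, hd⟩
  simp [flipPath] at this

lemma wordVertex_flipPath {d : Fin a → ℕ} {u : Fin (n + 1) → Fin m × Fin a}
    (hu : u ∈ words m (n + 1) d) (e : (i : Fin a) → Fin (d i) → ZMod 2)
    (h0 : ((u (Fin.last n)).1 : ℕ) = 0) {l : ℕ} (hl : l ≤ n) :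
    wordVertex u (flipPath (u (Fin.last n)).2 e) l =
      signShift (fun i => if i = (u (Fin.last n)).2 then 1 else 0) (wordVertex u e l) := by
  funext t i
  simp only [wordVertex, signShift, Prod.mk.injEq, true_and]
  by_cases hi : i = (u (Fin.last n)).2
  · subst hi
    have h1 : 1 ≤ posCount u l t (u (Fin.last n)).2 := by
      refine le_trans ?_ (single_le_sum (fun k _ => Nat.zero_le _) (mem_univ (Fin.last n)))
      have : (u (Fin.last n)).1 < t ∨ ((u (Fin.last n)).1 = t ∧ l ≤ (Fin.last n : ℕ)) := by
        rcases Nat.eq_zero_or_pos t with ht | ht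
        · right; exact ⟨Fin.ext (h0.trans ht.symm), by simpa using hl⟩
        · left; exact Fin.lt_def.2 (by omega)
      rw [if_pos ⟨rfl, this⟩]
    have h2 := posCount_le hu l t (u (Fin.last n)).2
    have h3 : 1 ≤ posCount u l t (u (Fin.last n)).2 ∧
      posCount u l t (u (Fin.last n)).2 - 1 < d (u (Fin.last n)).2 := ⟨h1, by omega⟩
    rw [signAt, signAt, dif_pos h3, dif_pos h3]
    simp [flipPath]
  · unfold signAt flipPath
    simp [hi]

/-- Move a letter to the next slot. -/
def slotUp (x : Fin m × Fin a) : Fin m × Fin a :=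
  if h : (x.1 : ℕ) + 1 < m then (⟨x.1 + 1, h⟩, x.2) else x

/-- Move a letter to the previous slot. -/
def slotDown (x : Fin m × Fin a) : Fin m × Fin a :=
  (⟨x.1 - 1, by omega⟩, x.2)

@[simp] lemma slotUp_snd (x : Fin m × Fin a) : (slotUp x).2 = x.2 := by
  unfold slotUp; split_ifs <;> rfl

lemma slotUp_fst {x : Fin m × Fin a} (h : (x.1 : ℕ) + 1 < m) : ((slotUp x).1 : ℕ) = x.1 + 1 := by
  rw [slotUp, dif_pos h]

lemma slotUp_slotDown {x : Fin m × Fin a} (h : (x.1 : ℕ) ≠ 0) : slotUp (slotDown x) = x := by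
  have h1 := x.1.2
  have : ((slotDown x).1 : ℕ) = x.1 - 1 := rfl
  refine Prod.ext (Fin.ext ?_) (by rw [slotUp_snd]; rfl)
  rw [slotUp_fst] <;> omega

lemma slotDown_slotUp {x : Fin m × Fin a} (h : (x.1 : ℕ) + 1 < m) : slotDown (slotUp x) = x := by
  refine Prod.ext (Fin.ext ?_) (by rw [slotDown, slotUp_snd])
  have : ((slotDown (slotUp x)).1 : ℕ) = (slotUp x).1 - 1 := rfl
  rw [this, slotUp_fst h]; rfl

lemma snoc_tail_mem_words {d : Fin a → ℕ} {u : Fin (n + 1) → Fin m × Fin a}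
    (hu : u ∈ words m (n + 1) d) {x : Fin m × Fin a} (hx : x.2 = (u 0).2) :
    (Fin.snoc (Fin.tail u) x : Fin (n + 1) → Fin m × Fin a) ∈ words m (n + 1) d := by
  rw [mem_words] at hu ⊢
  intro i
  rw [← hu i, Fin.sum_univ_castSucc, Fin.sum_univ_succ]
  simp [Fin.tail, hx, add_comm]

lemma cons_init_mem_words {d : Fin a → ℕ} {u : Fin (n + 1) → Fin m × Fin a}
    (hu : u ∈ words m (n + 1) d) {x : Fin m × Fin a} (hx : x.2 = (u (Fin.last n)).2) :
    (Fin.cons x (Fin.init u) : Fin (n + 1) → Fin m × Fin a) ∈ words m (n + 1) d := by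
  rw [mem_words] at hu ⊢
  intro i
  rw [← hu i, Fin.sum_univ_succ, Fin.sum_univ_castSucc]
  simp [Fin.init, hx, add_comm]

lemma posCount_snoc_tail (u : Fin (n + 1) → Fin m × Fin a) (h : ((u 0).1 : ℕ) + 1 < m) {l : ℕ}
    (hl : l ≤ n) (t : Fin m) (i : Fin a) :
    posCount (Fin.snoc (Fin.tail u) (slotUp (u 0)) : Fin (n + 1) → Fin m × Fin a) l t i =
      posCount u (l + 1) t i := by
  unfold posCount
  rw [Fin.sum_univ_castSucc, Fin.sum_univ_succ, add_comm]
  congr 1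
  · simp only [Fin.snoc_last, slotUp_snd, Fin.val_last, Fin.val_zero]
    congr 1
    simp only [hl, and_true, eq_iff_iff, and_congr_right_iff, Fin.lt_def, Fin.ext_iff,
      slotUp_fst h]
    intro _
    constructor
    · rintro (h | h) <;> left <;> omega
    · rintro (h | h) <;> omega
  · refine sum_congr rfl fun k _ => ?_
    simp [Fin.tail]

open Classical in
lemma sum_dropAt_boundary (d : Fin a → ℕ) (ψ : (ℕ → SVertex m a) → ZMod 2)
    (hψ : ∀ w w' : ℕ → SVertex m a, (∀ l ≤ n, w l = w' l) → ψ w = ψ w')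
    (hinv : ∀ g w, ψ (fun l => signShift g (w l)) = ψ w) :
    ∑ x ∈ words m (n + 1) d ×ˢ (univ : Finset ((i : Fin a) → Fin (d i) → ZMod 2)),
      ψ (dropAt 0 (wordVertex x.1 x.2)) =
    ∑ x ∈ words m (n + 1) d ×ˢ (univ : Finset ((i : Fin a) → Fin (d i) → ZMod 2)),
      ψ (dropAt (n + 1) (wordVertex x.1 x.2)) := by
  have hlast : ∀ v : ℕ → SVertex m a, ψ (dropAt (n + 1) v) = ψ v := fun v =>
    hψ _ _ fun l hl => by simp [dropAt, Nat.lt_succ_of_le hl]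
  simp only [hlast, dropAt_zero]
  rw [← sum_filter_add_sum_filter_not _ (fun x => ((x.1 0).1 : ℕ) + 1 < m),
    ← sum_filter_add_sum_filter_not (words m (n + 1) d ×ˢ univ)
      (fun x => ((x.1 (Fin.last n)).1 : ℕ) ≠ 0) (fun x => ψ (wordVertex x.1 x.2))]
  congr 1
  · refine sum_nbij' (fun x => (Fin.snoc (Fin.tail x.1) (slotUp (x.1 0)), x.2))
      (fun x => (Fin.cons (slotDown (x.1 (Fin.last n))) (Fin.init x.1), x.2)) ?_ ?_ ?_ ?_ ?_
    · rintro ⟨u, e⟩ hx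
      simp only [mem_filter, mem_product, mem_univ, and_true] at hx ⊢
      exact ⟨snoc_tail_mem_words hx.1 (slotUp_snd _), by simp [slotUp_fst hx.2]⟩
    · rintro ⟨u, e⟩ hx
      simp only [mem_filter, mem_product, mem_univ, and_true] at hx ⊢
      refine ⟨cons_init_mem_words hx.1 rfl, ?_⟩
      have : ((slotDown (u (Fin.last n))).1 : ℕ) = (u (Fin.last n)).1 - 1 := rfl
      have := (u (Fin.last n)).1.2
      simp only [Fin.cons_zero]
      omega
    · rintro ⟨u, e⟩ hx
      simp only [mem_filter, mem_product, mem_univ, and_true] at hx ⊢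
      simp [slotDown_slotUp hx.2]
    · rintro ⟨u, e⟩ hx
      simp only [mem_filter, mem_product, mem_univ, and_true] at hx ⊢
      simp [slotUp_slotDown hx.2]
    · rintro ⟨u, e⟩ hx
      simp only [mem_filter, mem_product, mem_univ, and_true] at hx ⊢
      refine hψ _ _ fun l hl => ?_
      funext t i
      simp only [wordVertex, posCount_snoc_tail u hx.2 hl]
  · trans 0
    · refine sum_involution (fun x _ => (x.1, flipSign (x.1 0).2 (d (x.1 0).2) x.2)) ?_ ?_ ?_ ?_
      · rintro ⟨u, e⟩ hx
        simp only [mem_filter, mem_product, mem_univ, and_true] at hx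
        have : ∀ l, wordVertex u (flipSign (u 0).2 (d (u 0).2) e) (l + 1) =
            wordVertex u e (l + 1) := by
          intro l
          apply wordVertex_flipSign
          intro t
          apply ne_of_lt
          rw [← mem_words.1 hx.1 (u 0).2]
          refine sum_lt_sum (fun k _ => ?_) ⟨0, mem_univ _, ?_⟩
          · split_ifs <;> simp_all
          · rw [if_neg, if_pos rfl]
            · exact zero_lt_one
            · rintro ⟨_, h | ⟨h, h'⟩⟩
              · have := t.2
                have := Fin.lt_def.1 h
                omega
              · simp at h'
        simp only [this]
        exact CharTwo.add_self_eq_zero _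
      · rintro ⟨u, e⟩ hx _ h
        simp only [mem_filter, mem_product, mem_univ, and_true] at hx
        exact flipSign_ne _ (words_type_pos hx.1 0) le_rfl e (congrArg Prod.snd h)
      · rintro ⟨u, e⟩ hx
        simpa using hx
      · rintro ⟨u, e⟩ hx
        simp [flipSign_flipSign]
    · symm
      refine sum_involution (fun x _ => (x.1, flipPath (x.1 (Fin.last n)).2 x.2)) ?_ ?_ ?_ ?_
      · rintro ⟨u, e⟩ hx
        simp only [mem_filter, mem_product, mem_univ, and_true, not_not] at hx
        rw [hψ (wordVertex u (flipPath (u (Fin.last n)).2 e)) _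
          fun l hl => wordVertex_flipPath hx.1 e hx.2 hl, hinv]
        exact CharTwo.add_self_eq_zero _
      · rintro ⟨u, e⟩ hx _ h
        simp only [mem_filter, mem_product, mem_univ, and_true] at hx
        exact flipPath_ne _ (words_type_pos hx.1 _) e (congrArg Prod.snd h)
      · rintro ⟨u, e⟩ hx
        simpa using hx
      · rintro ⟨u, e⟩ hx
        simp [flipPath_flipPath]

/-- The chain of all signed words is a `G`-cycle: invariant functions of the boundary vanish. -/
lemma sum_boundary_eq_zero (d : Fin a → ℕ) (ψ : (ℕ → SVertex m a) → ZMod 2)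
    (hψ : ∀ w w' : ℕ → SVertex m a, (∀ l ≤ n, w l = w' l) → ψ w = ψ w')
    (hinv : ∀ g w, ψ (fun l => signShift g (w l)) = ψ w) :
    ∑ x ∈ words m (n + 1) d ×ˢ (univ : Finset ((i : Fin a) → Fin (d i) → ZMod 2)),
      ∑ j ∈ range (n + 2), ψ (dropAt j (wordVertex x.1 x.2)) = 0 := by
  rw [sum_comm, sum_range_succ, sum_range_succ', sum_eq_zero, zero_add,
    sum_dropAt_boundary d ψ hψ hinv]
  · exact CharTwo.add_self_eq_zero _
  · intro j hj
    exact sum_dropAt_interior d ψ (by have := mem_range.1 hj; omega)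

end LatticeParity

section BorsukUlam

open Finset

variable {m a n : ℕ}

open Classical in
/-- The mod 2 count of signed words all of whose edges are separated by the labellings `s`. -/
noncomputable def wordSum (m n : ℕ) (d : Fin a → ℕ) (s : ℕ → SVertex m a → ZMod 2) : ZMod 2 :=
  ∑ x ∈ words m (n + 1) d ×ˢ (univ : Finset ((i : Fin a) → Fin (d i) → ZMod 2)),
    cupProd (n + 1) s (wordVertex x.1 x.2)

/-- `s` is a labelling equivariant with respect to the character `χ`. -/
def SignEquivariant (χ : Fin a → ZMod 2) (s : SVertex m a → ZMod 2) : Prop :=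
  ∀ g w, s (signShift g w) = s w + ∑ i, χ i * g i

lemma cupProd_signShift {N : ℕ} {χ : ℕ → Fin a → ZMod 2} {s : ℕ → SVertex m a → ZMod 2}
    (hs : ∀ l < N, SignEquivariant (χ l) (s l)) (g : Fin a → ZMod 2) (w : ℕ → SVertex m a) :
    cupProd N s (fun l => signShift g (w l)) = cupProd N s w := by
  refine prod_congr rfl fun l hl => ?_
  rw [hs l (mem_range.1 hl), hs l (mem_range.1 hl)]
  linear_combination zmod_two_add_self (∑ i, χ l i * g i)

lemma wordSum_update {d : Fin a → ℕ} {χ : ℕ → Fin a → ZMod 2} {s : ℕ → SVertex m a → ZMod 2}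
    (hs : ∀ l < n + 1, SignEquivariant (χ l) (s l)) {k : ℕ} (hk : k < n + 1)
    {s' : SVertex m a → ZMod 2} (hs' : SignEquivariant (χ k) s') :
    wordSum m n d (Function.update s k s') = wordSum m n d s := by
  obtain ⟨q, rfl⟩ : ∃ q, n = k + q := ⟨n - k, by omega⟩
  let h : SVertex m a → ZMod 2 := fun w => s' w - s k w
  have hh : ∀ g w, h (signShift g w) = h w := by
    intro g w
    simp only [h]
    rw [hs', hs k hk]; ring
  have key := sum_boundary_eq_zero (m := m) (n := k + q) d (cupInsert k q s h) ?_ ?_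
  · rw [← sub_eq_zero, wordSum, wordSum, ← sum_sub_distrib, ← key]
    refine sum_congr rfl fun x _ => ?_
    rw [sum_cupInsert_dropAt]
    generalize wordVertex x.1 x.2 = v
    rw [show k + q + 1 = k + 1 + q by ring, cupProd_split, cupProd_split]
    rw [cupProd_congr (s := Function.update s k s') (s' := s) (n := k)
      (fun l hl => Function.update_of_ne hl.ne _ _) (fun _ _ => rfl)]
    have : (fun l => Function.update s k s' (l + (k + 1))) = fun l => s (l + (k + 1)) := by
      funext l; exact Function.update_of_ne (by omega) _ _
    rw [this, Function.update_self]
    simp only [h]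
    ring
  · intro w w' hw
    unfold cupInsert
    congr 1
    · exact cupProd_congr (fun _ _ => rfl) fun l hl => hw l (by omega)
    · rw [hw k (by omega)]
      congr 1
      exact cupProd_congr (fun _ _ => rfl) fun l hl => hw _ (by omega)
  · intro g w
    unfold cupInsert
    rw [hh, cupProd_signShift (fun l hl => hs l (by omega)),
      cupProd_signShift (w := fun l => w (l + k)) (χ := fun l => χ (l + (k + 1)))
      (fun l hl => hs _ (by omega))]

lemma wordSum_congr {d : Fin a → ℕ} {s s' : ℕ → SVertex m a → ZMod 2}
    (h : ∀ l < n + 1, s l = s' l) : wordSum m n d s = wordSum m n d s' :=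
  sum_congr rfl fun _ _ => cupProd_congr h fun _ _ => rfl

lemma wordSum_eq {d : Fin a → ℕ} {χ : ℕ → Fin a → ZMod 2} {s s' : ℕ → SVertex m a → ZMod 2}
    (hs : ∀ l < n + 1, SignEquivariant (χ l) (s l))
    (hs' : ∀ l < n + 1, SignEquivariant (χ l) (s' l)) : wordSum m n d s = wordSum m n d s' := by
  have key : ∀ k ≤ n + 1, wordSum m n d (fun l => if l < k then s' l else s l) =
      wordSum m n d s := by
    intro k
    induction k with
    | zero => intro _; simp
    | succ k ih =>
      intro hk
      rw [← ih (by omega), ← wordSum_update (χ := χ) (s := fun l => if l < k then s' l else s l) ?_ (show k < n + 1 by omega)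
        (hs' k (by omega))]
      · congr 1
        funext l
        rcases lt_trichotomy l k with h | rfl | h
        · rw [Function.update_of_ne h.ne, if_pos (by omega), if_pos h]
        · rw [Function.update_self, if_pos (Nat.lt_succ_self _)]
        · rw [Function.update_of_ne h.ne', if_neg (by omega), if_neg (by omega)]
      · intro l hl
        split_ifs
        · exact hs' l hl
        · exact hs l hl
  rw [← key (n + 1) le_rfl]
  exact wordSum_congr fun l hl => by simp only [hl, if_true]

/-- The reference labelling. -/
def refLabel (hm : 0 < m) (χ : Fin a → ZMod 2) (w : SVertex m a) : ZMod 2 :=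
  ∑ i, χ i * (w ⟨0, hm⟩ i).2

lemma refLabel_equivariant (hm : 0 < m) (χ : Fin a → ZMod 2) :
    SignEquivariant χ (refLabel hm χ) := by
  intro g w
  simp [refLabel, signShift, mul_add, sum_add_distrib]

lemma signAt_zero {d : Fin a → ℕ} (e : (i : Fin a) → Fin (d i) → ZMod 2) (i : Fin a) :
    signAt e i 0 = 0 := by simp [signAt]

lemma posCount_step {N : ℕ} (u : Fin N → Fin m × Fin a) (l : Fin N) (t : Fin m) (i : Fin a) :
    posCount u l t i = posCount u (l + 1) t i + if u l = (t, i) then 1 else 0 := by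
  unfold posCount
  rw [← sum_add_sum_compl {l}, ← sum_add_sum_compl {l} (fun k : Fin N => if (u k).2 = i ∧ ((u k).1 < t ∨ ((u k).1 = t ∧ (l : ℕ) + 1 ≤ k)) then 1 else 0)]
  rw [add_right_comm]
  congr 1
  · simp only [sum_singleton, le_refl, and_true]
    by_cases h1 : (u l).2 = i <;> by_cases h2 : (u l).1 = t
    · have : u l = (t, i) := Prod.ext h2 h1
      simp [this]
    · have : ¬ u l = (t, i) := fun h => h2 (by rw [h])
      simp [h1, h2, this]
    · have : ¬ u l = (t, i) := fun h => h1 (by rw [h])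
      simp [h1, this]
    · have : ¬ u l = (t, i) := fun h => h1 (by rw [h])
      simp [h1, this]
  · refine sum_congr rfl fun k hk => ?_
    have : k ≠ l := by simpa using hk
    have : (k : ℕ) ≠ l := fun h => this (Fin.ext h)
    have e : (l : ℕ) ≤ k ↔ (l : ℕ) + 1 ≤ k := by omega
    simp only [e]

lemma posCount_end {N : ℕ} (u : Fin N → Fin m × Fin a) {t : Fin m} (ht : (t : ℕ) = 0)
    (i : Fin a) : posCount u N t i = 0 := by
  refine sum_eq_zero fun k _ => if_neg ?_
  rintro ⟨_, h | ⟨_, h⟩⟩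
  · have := Fin.lt_def.1 h; omega
  · have := k.2; omega

lemma posCount_start {N : ℕ} {d : Fin a → ℕ} {u : Fin N → Fin m × Fin a} (hu : u ∈ words m N d)
    {t : Fin m} (ht : ∀ k, (u k).1 = t) (i : Fin a) : posCount u 0 t i = d i := by
  rw [← mem_words.1 hu i]
  refine sum_congr rfl fun k _ => ?_
  simp [ht]

variable {d : Fin a → ℕ}

lemma refLabel_step (hm : 0 < m) (χ : Fin a → ZMod 2) {N : ℕ} (u : Fin N → Fin m × Fin a)
    (e : (i : Fin a) → Fin (d i) → ZMod 2) (l : Fin N) :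
    refLabel hm χ (wordVertex u e l) + refLabel hm χ (wordVertex u e (l + 1)) =
      if (u l).1 = ⟨0, hm⟩ then χ (u l).2 *
        (signAt e (u l).2 (posCount u (l + 1) ⟨0, hm⟩ (u l).2 + 1) +
          signAt e (u l).2 (posCount u (l + 1) ⟨0, hm⟩ (u l).2)) else 0 := by
  simp only [refLabel, wordVertex, ← sum_add_distrib, posCount_step u l, ← mul_add]
  split_ifs with h
  · rw [sum_eq_single (u l).2]
    · rw [if_pos (show u l = (⟨0, hm⟩, (u l).2) from Prod.ext h rfl)]
    · intro i _ hi
      rw [if_neg (fun h' => hi (by rw [h'])), add_zero, CharTwo.add_self_eq_zero, mul_zero]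
    · simp
  · refine sum_eq_zero fun i _ => ?_
    rw [if_neg (fun h' => h (by rw [h'])), add_zero, CharTwo.add_self_eq_zero, mul_zero]

/-- Alternating signs. -/
def altSign : (i : Fin a) → Fin (d i) → ZMod 2 := fun _ q => ((q + 1 : ℕ) : ZMod 2)

lemma signAt_altSign {i : Fin a} {p : ℕ} (hp : p ≤ d i) :
    signAt (altSign (d := d)) i p = p := by
  unfold signAt altSign
  split_ifs with h
  · simp only; rw [Nat.sub_add_cancel h.1]
  · have : p = 0 := by omega
    simp [this]

lemma eq_altSign {u : Fin (n + 1) → Fin m × Fin a} (hu : u ∈ words m (n + 1) d) (hm : 0 < m)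
    (h0 : ∀ k, (u k).1 = ⟨0, hm⟩) {e : (i : Fin a) → Fin (d i) → ZMod 2}
    (h : ∀ l : Fin (n + 1), (signAt e (u l).2 (posCount u (l + 1) ⟨0, hm⟩ (u l).2 + 1) +
          signAt e (u l).2 (posCount u (l + 1) ⟨0, hm⟩ (u l).2)) ≠ 0) : e = altSign := by
  have key : ∀ l ≤ n + 1, ∀ i, ∀ p ≤ posCount u l ⟨0, hm⟩ i, signAt e i p = p := by
    intro l hl
    induction hl using Nat.decreasingInduction with
    | self =>
      intro i p hp
      rw [posCount_end u rfl] at hp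
      rw [Nat.le_zero.1 hp, signAt_zero, Nat.cast_zero]
    | of_succ l hl ih =>
      intro i p hp
      have h1 := posCount_step u ⟨l, by omega⟩ ⟨0, hm⟩ i
      simp only at h1
      split_ifs at h1 with h2
      · rcases Nat.lt_or_ge (posCount u (l + 1) ⟨0, hm⟩ i) p with h3 | h3
        · have h4 : p = posCount u (l + 1) ⟨0, hm⟩ i + 1 := by omega
          have h5 := h ⟨l, by omega⟩
          rw [h2] at h5
          simp only at h5
          rw [← h4, ih i _ le_rfl] at h5
          have : ∀ x y : ZMod 2, x + y ≠ 0 → x = y + 1 := by decide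
          rw [this _ _ h5, h4]; push_cast; rfl
        · exact ih i p h3
      · exact ih i p (by omega)
  funext i q
  have h1 := key 0 (Nat.zero_le _) i (q + 1) (by rw [posCount_start hu h0]; exact q.2)
  rw [signAt, dif_pos ⟨by omega, by simp⟩] at h1
  simpa [altSign] using h1

lemma wordSum_refLabel (hm : 0 < m) (χ : ℕ → Fin a → ZMod 2) (top : ℕ → Fin a)
    (htop : ∀ l < n + 1, χ l (top l) = 1) (hχ : ∀ l < n + 1, ∀ i, top l < i → χ l i = 0)
    (hd : ∀ i, (∑ l : Fin (n + 1), if top l = i then 1 else 0) = d i) :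
    wordSum m n d (fun l => refLabel hm (χ l)) = 1 := by
  classical
  have hu0 : (fun l : Fin (n + 1) => ((⟨0, hm⟩ : Fin m), top l)) ∈ words m (n + 1) d := by
    rw [mem_words]; exact hd
  unfold wordSum
  have hterm : ∀ (u : Fin (n + 1) → Fin m × Fin a) (e : (i : Fin a) → Fin (d i) → ZMod 2),
      cupProd (n + 1) (fun l => refLabel hm (χ l)) (wordVertex u e) =
      ∏ l : Fin (n + 1), if (u l).1 = ⟨0, hm⟩ then χ l (u l).2 *
        (signAt e (u l).2 (posCount u (l + 1) ⟨0, hm⟩ (u l).2 + 1) +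
          signAt e (u l).2 (posCount u (l + 1) ⟨0, hm⟩ (u l).2)) else 0 := by
    intro u e
    rw [cupProd, ← Fin.prod_univ_eq_prod_range (fun l => refLabel hm (χ l) (wordVertex u e l) + refLabel hm (χ l) (wordVertex u e (l + 1)))]
    exact prod_congr rfl fun l _ => refLabel_step hm (χ l) u e l
  rw [sum_eq_single (fun l : Fin (n + 1) => ((⟨0, hm⟩ : Fin m), top l), altSign)]
  · rw [hterm]
    refine prod_eq_one fun l _ => ?_
    simp only [if_true]
    rw [htop l l.2, one_mul]
    have h1 := posCount_step (fun l : Fin (n + 1) => ((⟨0, hm⟩ : Fin m), top l)) l ⟨0, hm⟩ (top l)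
    simp only [if_true] at h1
    have h2 := posCount_le hu0 l ⟨0, hm⟩ (top l)
    rw [signAt_altSign (by omega), signAt_altSign (by omega)]
    push_cast
    linear_combination zmod_two_add_self ((posCount (fun l : Fin (n + 1) => ((⟨0, hm⟩ : Fin m), top l)) (l + 1) ⟨0, hm⟩ (top l) : ℕ) : ZMod 2)
  · rintro ⟨u, e⟩ hx hne
    simp only [mem_product, mem_univ, and_true] at hx
    by_contra hprod
    apply hne
    simp only at hprod
    rw [hterm] at hprod
    have hl := prod_ne_zero_iff.1 hprod
    have h0 : ∀ l, (u l).1 = ⟨0, hm⟩ := by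
      intro l
      by_contra h
      exact hl l (mem_univ _) (if_neg h)
    have h1 : ∀ l : Fin (n + 1), χ l (u l).2 ≠ 0 ∧ (signAt e (u l).2 (posCount u (l + 1) ⟨0, hm⟩ (u l).2 + 1) +
          signAt e (u l).2 (posCount u (l + 1) ⟨0, hm⟩ (u l).2)) ≠ 0 := by
      intro l
      have := hl l (mem_univ _)
      rw [if_pos (h0 l)] at this
      exact ⟨left_ne_zero_of_mul this, right_ne_zero_of_mul this⟩
    have h2 : ∀ l : Fin (n + 1), (u l).2 ≤ top l := fun l => by
      by_contra h
      exact (h1 l).1 (hχ l l.2 _ (not_le.1 h))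
    have hsum : ∀ f : Fin (n + 1) → Fin a,
        (∀ i, (∑ l : Fin (n + 1), if f l = i then 1 else 0) = d i) →
        ∑ l, (f l : ℕ) = ∑ i : Fin a, (i : ℕ) * d i := by
      intro f hf
      simp only [← hf, mul_sum]
      rw [sum_comm]
      refine sum_congr rfl fun l _ => ?_
      simp
    have h3 : ∀ l : Fin (n + 1), ((u l).2 : ℕ) = top l := by
      have := (sum_eq_sum_iff_of_le (s := univ) (f := fun l : Fin (n + 1) => ((u l).2 : ℕ))
        (g := fun l : Fin (n + 1) => (top l : ℕ)) fun l _ => h2 l).1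
        ((hsum _ (mem_words.1 hx)).trans (hsum (fun l => top l) hd).symm)
      exact fun l => this l (mem_univ _)
    refine Prod.ext (funext fun l => Prod.ext (h0 l) (Fin.ext (h3 l))) ?_
    exact eq_altSign hx hm h0 fun l => (h1 l).2
  · intro h
    exact absurd (mem_product.2 ⟨hu0, mem_univ _⟩) h

/-- Combinatorial Borsuk–Ulam theorem for the group `(ℤ/2)^a`. -/
theorem exists_separated_word (hm : 0 < m) (χ : ℕ → Fin a → ZMod 2) (top : ℕ → Fin a)
    (htop : ∀ l < n + 1, χ l (top l) = 1) (hχ : ∀ l < n + 1, ∀ i, top l < i → χ l i = 0)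
    (hd : ∀ i, (∑ l : Fin (n + 1), if top l = i then 1 else 0) = d i)
    (s : ℕ → SVertex m a → ZMod 2) (hs : ∀ l < n + 1, SignEquivariant (χ l) (s l)) :
    ∃ u ∈ words m (n + 1) d, ∃ e : (i : Fin a) → Fin (d i) → ZMod 2,
      ∀ l < n + 1, s l (wordVertex u e l) ≠ s l (wordVertex u e (l + 1)) := by
  have h1 : wordSum m n d s = 1 := by
    rw [wordSum_eq hs (s' := fun l => refLabel hm (χ l))
      fun l _ => refLabel_equivariant hm (χ l), wordSum_refLabel hm χ top htop hχ hd]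
  obtain ⟨⟨u, e⟩, hx, hne⟩ := exists_ne_zero_of_sum_ne_zero (h1.trans_ne one_ne_zero)
  refine ⟨u, (mem_product.1 hx).1, e, fun l hl h => ?_⟩
  refine prod_ne_zero_iff.1 hne l (mem_range.2 hl) ?_
  simp only [h, CharTwo.add_self_eq_zero]

end BorsukUlam

section NearCoincidence

open Finset

variable {m a k : ℕ}

/-- The nontrivial character of `ℤ/2`. -/
def pm (x : ZMod 2) : ℝ := if x = 0 then 1 else -1

lemma pm_add (x y : ZMod 2) : pm (x + y) = pm x * pm y := by
  have h : ∀ x : ZMod 2, x = 0 ∨ x = 1 := by decide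
  have h1 : (1 : ZMod 2) ≠ 0 := by decide
  have h2 : (1 : ZMod 2) + 1 = 0 := by decide
  rcases h x with rfl | rfl <;> rcases h y with rfl | rfl <;> simp [pm, h2]

lemma abs_pm (x : ZMod 2) : |pm x| = 1 := by
  unfold pm; split_ifs <;> simp

/-- The pairing of a character with a group element. -/
def dot (χ g : Fin a → ZMod 2) : ZMod 2 := ∑ i, χ i * g i

lemma dot_add (χ g h : Fin a → ZMod 2) : dot χ (g + h) = dot χ g + dot χ h := by
  simp [dot, mul_add, sum_add_distrib]

lemma add_dot (χ χ' g : Fin a → ZMod 2) : dot (χ + χ') g = dot χ g + dot χ' g := by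
  simp [dot, add_mul, sum_add_distrib]

lemma sum_pm_dot (h : Fin a → ZMod 2) :
    ∑ χ : Fin a → ZMod 2, pm (dot χ h) = if h = 0 then (2 : ℝ) ^ a else 0 := by
  split_ifs with h0
  · subst h0
    simp [dot, pm]
  · obtain ⟨i, hi⟩ : ∃ i, h i ≠ 0 := Function.ne_iff.1 h0
    have h1 : h i = 1 := by
      have : ∀ x : ZMod 2, x ≠ 0 → x = 1 := by decide
      exact this _ hi
    have h2 : dot (Pi.single i 1) h = 1 := by
      rw [dot, sum_eq_single i] <;> simp +contextual [h1]
    have key : ∑ χ : Fin a → ZMod 2, pm (dot χ h) = - ∑ χ : Fin a → ZMod 2, pm (dot χ h) := by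
      conv_lhs => rw [← Equiv.sum_comp (Equiv.addRight (Pi.single i 1))]
      rw [← sum_neg_distrib]
      refine sum_congr rfl fun χ _ => ?_
      rw [Equiv.coe_addRight, add_dot, h2, pm_add]
      simp [pm]
    linarith

/-- The Walsh transform of a real function along an orbit. -/
def walsh (φ : SVertex m a → ℝ) (χ : Fin a → ZMod 2) (w : SVertex m a) : ℝ :=
  ∑ g : Fin a → ZMod 2, pm (dot χ g) * φ (signShift g w)

lemma signShift_signShift (g h : Fin a → ZMod 2) (w : SVertex m a) :
    signShift g (signShift h w) = signShift (g + h) w := by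
  funext t i
  simp [signShift, add_assoc, add_comm (g i)]

lemma signShift_zero (w : SVertex m a) : signShift 0 w = w := by
  funext t i
  simp [signShift]

lemma add_self_fun (h : Fin a → ZMod 2) : h + h = 0 := by
  funext i; exact CharTwo.add_self_eq_zero _

lemma walsh_signShift (φ : SVertex m a → ℝ) (χ h : Fin a → ZMod 2) (w : SVertex m a) :
    walsh φ χ (signShift h w) = pm (dot χ h) * walsh φ χ w := by
  unfold walsh
  rw [← Equiv.sum_comp (Equiv.addRight h), mul_sum]
  refine sum_congr rfl fun g _ => ?_
  rw [Equiv.coe_addRight, signShift_signShift, add_assoc, add_self_fun, add_zero, dot_add, pm_add]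
  ring

lemma sum_walsh (φ : SVertex m a → ℝ) (g : Fin a → ZMod 2) (w : SVertex m a) :
    ∑ χ, pm (dot χ g) * walsh φ χ w = 2 ^ a * φ (signShift g w) := by
  simp only [walsh, mul_sum]
  rw [sum_comm]
  have : ∀ h : Fin a → ZMod 2, ∑ χ, pm (dot χ g) * (pm (dot χ h) * φ (signShift h w)) =
      if h = g then 2 ^ a * φ (signShift h w) else 0 := by
    intro h
    simp only [← mul_assoc, ← pm_add, ← dot_add, ← sum_mul, sum_pm_dot]
    have e : g + h = 0 ↔ h = g := by
      constructor
      · intro h0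
        have := congrArg (g + ·) h0
        simpa only [← add_assoc, add_self_fun, zero_add, add_zero] using this
      · rintro rfl; exact add_self_fun h
    simp only [e, ite_mul, zero_mul]
  simp only [this, sum_ite_eq', mem_univ, if_true]

lemma abs_sub_le_of_walsh (φ : SVertex m a → ℝ) (w : SVertex m a) {B : ℝ} (hB0 : 0 ≤ B)
    (hB : ∀ χ ≠ 0, |walsh φ χ w| ≤ B) (g : Fin a → ZMod 2) :
    |φ (signShift g w) - φ w| ≤ 2 * B := by
  have h1 := sum_walsh φ g w
  have h2 := sum_walsh φ 0 w
  rw [signShift_zero] at h2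
  have h3 : 2 ^ a * (φ (signShift g w) - φ w) =
      ∑ χ, (pm (dot χ g) - pm (dot χ 0)) * walsh φ χ w := by
    simp only [sub_mul, sum_sub_distrib, h1, h2, mul_sub]
  have hB' : ∀ χ, |(pm (dot χ g) - pm (dot χ 0)) * walsh φ χ w| ≤ 2 * B := by
    intro χ
    rw [abs_mul]
    by_cases hχ : χ = 0
    · subst hχ
      simp [dot, hB0]
    · refine mul_le_mul ?_ (hB χ hχ) (abs_nonneg _) zero_le_two
      calc _ ≤ |pm (dot χ g)| + |pm (dot χ 0)| := abs_sub _ _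
        _ = 2 := by rw [abs_pm, abs_pm]; norm_num
  have h4 : |2 ^ a * (φ (signShift g w) - φ w)| ≤ 2 ^ a * (2 * B) := by
    rw [h3]
    refine (abs_sum_le_sum_abs _ _).trans ((sum_le_sum fun χ _ => hB' χ).trans ?_)
    simp
  rw [abs_mul, abs_of_pos (by positivity)] at h4
  exact le_of_mul_le_mul_left h4 (by positivity)

open Classical in
/-- The sign of the Walsh transform, ties being broken by the reference labelling. -/
noncomputable def walshSign (hm : 0 < m) (φ : SVertex m a → ℝ) (χ : Fin a → ZMod 2)
    (w : SVertex m a) : ZMod 2 :=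
  if 0 < walsh φ χ w then 0 else if walsh φ χ w < 0 then 1 else refLabel hm χ w

lemma walshSign_equivariant (hm : 0 < m) (φ : SVertex m a → ℝ) (χ : Fin a → ZMod 2) :
    SignEquivariant χ (walshSign hm φ χ) := by
  intro g w
  unfold walshSign
  rw [walsh_signShift, refLabel_equivariant hm χ g w]
  change _ = _ + dot χ g
  change (if _ then _ else if _ then _ else _ + dot χ g) = _
  have h : ∀ x : ZMod 2, x = 0 ∨ x = 1 := by decide
  have h2 : (1 : ZMod 2) + 1 = 0 := by decide
  rcases h (dot χ g) with h0 | h0 <;> rw [h0]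
  · simp [pm]
  · rcases lt_trichotomy (walsh φ χ w) 0 with h1 | h1 | h1
    · simp [pm, h1, h2, not_lt.2 h1.le]
    · simp [pm, h1]
    · simp [pm, h1, not_lt.2 h1.le]

lemma abs_walsh_le_of_sign_ne (hm : 0 < m) (φ : SVertex m a → ℝ) (χ : Fin a → ZMod 2)
    {w w' : SVertex m a} (h : walshSign hm φ χ w ≠ walshSign hm φ χ w') :
    |walsh φ χ w| ≤ |walsh φ χ w - walsh φ χ w'| := by
  unfold walshSign at h
  rcases lt_trichotomy (walsh φ χ w) 0 with h1 | h1 | h1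
  · have : 0 ≤ walsh φ χ w' := by
      by_contra h2
      push Not at h2
      simp [h1, h2, not_lt.2 h1.le, not_lt.2 h2.le] at h
    rw [abs_of_neg h1, abs_of_neg (by linarith)]; linarith
  · rw [h1]; simp
  · have : walsh φ χ w' ≤ 0 := by
      by_contra h2
      push Not at h2
      simp [h1, h2] at h
    rw [abs_of_pos h1, abs_of_nonneg (by linarith)]; linarith

/-- `i` is the largest index in the support of `χ`. -/
def HasTopIndex (χ : Fin a → ZMod 2) (i : Fin a) : Prop := χ i ≠ 0 ∧ ∀ j, i < j → χ j = 0

lemma exists_hasTopIndex {χ : Fin a → ZMod 2} (h : χ ≠ 0) : ∃ i, HasTopIndex χ i := by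
  obtain ⟨i, hi⟩ : ∃ i, χ i ≠ 0 := Function.ne_iff.1 h
  have hne : (univ.filter fun i => χ i ≠ 0).Nonempty := ⟨i, by simpa using hi⟩
  refine ⟨_, (mem_filter.1 (max'_mem _ hne)).2, fun j hj => ?_⟩
  by_contra hj0
  exact absurd (le_max' _ j (by simpa using hj0)) (not_le.2 hj)

lemma HasTopIndex.unique {χ : Fin a → ZMod 2} {i j : Fin a} (hi : HasTopIndex χ i) (hj : HasTopIndex χ j) :
    i = j := by
  rcases lt_trichotomy i j with h | h | h
  · exact absurd (hi.2 j h) hj.1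
  · exact h
  · exact absurd (hj.2 i h) hi.1

lemma HasTopIndex.ne_zero {χ : Fin a → ZMod 2} {i : Fin a} (hi : HasTopIndex χ i) : χ ≠ 0 := by
  rintro rfl; exact hi.1 rfl

open Classical in
/-- `k` times the number of characters with top index `i`. -/
noncomputable def topCount (a k : ℕ) (i : Fin a) : ℕ :=
  k * #{χ : Fin a → ZMod 2 | HasTopIndex χ i}

lemma sum_card_hasTopIndex (top : {χ : Fin a → ZMod 2 // χ ≠ 0} → Fin a)
    (htop : ∀ χ, HasTopIndex χ.1 (top χ)) (k : ℕ) (i : Fin a) :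
    (∑ x : {χ : Fin a → ZMod 2 // χ ≠ 0} × Fin k, if top x.1 = i then 1 else 0) =
      topCount a k i := by
  classical
  rw [Fintype.sum_prod_type, sum_comm]
  simp only [sum_boole, Nat.cast_id, sum_const, card_univ, Fintype.card_fin, smul_eq_mul, topCount]
  congr 1
  refine card_bij (fun χ _ => χ.1) ?_ ?_ ?_
  · intro χ hχ
    simp only [mem_filter, mem_univ, true_and] at hχ ⊢
    exact hχ ▸ htop χ
  · intro χ _ χ' _ h
    exact Subtype.ext h
  · intro χ hχ
    simp only [mem_filter, mem_univ, true_and] at hχ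
    exact ⟨⟨χ, hχ.ne_zero⟩, by simpa using (htop _).unique hχ, rfl⟩

lemma signShift_congr {w w' : SVertex m a} {t : Fin m} (h : ∀ t' ≠ t, w t' = w' t')
    (g : Fin a → ZMod 2) : ∀ t' ≠ t, signShift g w t' = signShift g w' t' := by
  intro t' ht'
  funext i
  simp only [signShift, h t' ht']

lemma abs_walsh_sub_le {φ : SVertex m a → ℝ} {δ : ℝ} {w w' : SVertex m a}
    (h : ∀ g, |φ (signShift g w) - φ (signShift g w')| ≤ δ) (χ : Fin a → ZMod 2) :
    |walsh φ χ w - walsh φ χ w'| ≤ 2 ^ a * δ := by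
  unfold walsh
  rw [← sum_sub_distrib]
  refine (abs_sum_le_sum_abs _ _).trans ?_
  refine (sum_le_sum (g := fun _ => δ) fun g _ => ?_).trans ?_
  · rw [← mul_sub, abs_mul, abs_pm, one_mul]
    exact h g
  · simp

/-- If `φ` changes by at most `δ` whenever a single slot changes, then some signed word has an
initial vertex on whose orbit `φ` is nearly constant. -/
theorem exists_near_coincidence {N : ℕ} (hN : N = k * (2 ^ a - 1)) (ha : 0 < a) (hk : 0 < k) (hm : 0 < m)
    (φ : SVertex m a → Fin k → ℝ) {δ : ℝ} (hδ : 0 ≤ δ)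
    (hφ : ∀ w w' t, (∀ t' ≠ t, w t' = w' t') → ∀ c, |φ w c - φ w' c| ≤ δ) :
    ∃ u ∈ words m N (topCount a k),
      ∃ e : (i : Fin a) → Fin (topCount a k i) → ZMod 2, ∀ g c,
        |φ (signShift g (wordVertex u e 0)) c - φ (wordVertex u e 0) c| ≤
          2 * ((k * 2 ^ a) * (2 ^ a * δ)) := by
  classical
  have hcard : Fintype.card ({χ : Fin a → ZMod 2 // χ ≠ 0} × Fin k) = k * (2 ^ a - 1) := by
    rw [Fintype.card_prod, Fintype.card_fin, mul_comm, Fintype.card_subtype_compl]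
    simp [ZMod.card]
  have hle : ((k * (2 ^ a - 1) : ℕ) : ℝ) ≤ k * 2 ^ a := by
    have : k * (2 ^ a - 1) ≤ k * 2 ^ a := Nat.mul_le_mul_left _ (Nat.sub_le _ _)
    exact_mod_cast this
  have hpos : 0 < k * (2 ^ a - 1) := by
    have := Nat.one_lt_two_pow ha.ne'
    exact Nat.mul_pos hk (by omega)
  rw [← hN] at hcard hle hpos
  obtain ⟨n, rfl⟩ : ∃ n, N = n + 1 := ⟨N - 1, by omega⟩
  let E : Fin (n + 1) ≃ {χ : Fin a → ZMod 2 // χ ≠ 0} × Fin k :=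
    (Fintype.equivFinOfCardEq hcard).symm
  choose top htop using fun χ : {χ : Fin a → ZMod 2 // χ ≠ 0} => exists_hasTopIndex χ.2
  let F : ℕ → {χ : Fin a → ZMod 2 // χ ≠ 0} × Fin k := fun l =>
    if h : l < n + 1 then E ⟨l, h⟩ else E 0
  have hF : ∀ l : Fin (n + 1), F l = E l := fun l => by simp only [F, dif_pos l.2]
  obtain ⟨u, hu, e, hsep⟩ := exists_separated_word (m := m) (n := n) (d := topCount a k) hm
    (fun l => (F l).1.1) (fun l => top (F l).1)
    (fun l _ => by
      have : ∀ x : ZMod 2, x ≠ 0 → x = 1 := by decide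
      exact this _ (htop (F l).1).1)
    (fun l _ i hi => (htop (F l).1).2 i hi)
    (fun i => by
      simp only [hF]
      rw [Equiv.sum_comp E fun x => if top x.1 = i then 1 else 0]
      exact sum_card_hasTopIndex top htop k i)
    (fun l => walshSign hm (fun w => φ w (F l).2) (F l).1.1)
    (fun l _ => walshSign_equivariant hm _ _)
  refine ⟨u, hu, e, fun g c => ?_⟩
  set v := wordVertex u e with hv
  have hstep : ∀ l < n + 1, ∀ χ c, |walsh (fun w => φ w c) χ (v l) -
      walsh (fun w => φ w c) χ (v (l + 1))| ≤ 2 ^ a * δ := by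
    intro l hl χ c
    refine abs_walsh_sub_le (fun g => hφ _ _ (u ⟨l, hl⟩).1 (signShift_congr ?_ g) c) χ
    intro t' ht'
    funext i
    have := posCount_step u ⟨l, hl⟩ t' i
    rw [if_neg (fun h => ht' (by rw [h])), add_zero] at this
    simp only at this
    simp only [hv, wordVertex, this]
  have hdist : ∀ l ≤ n + 1, ∀ χ c, |walsh (fun w => φ w c) χ (v 0) -
      walsh (fun w => φ w c) χ (v l)| ≤ l * (2 ^ a * δ) := by
    intro l
    induction l with
    | zero => intro _ χ c; simp
    | succ l ih =>
      intro hl χ c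
      have h1 := ih (by omega) χ c
      have h2 := hstep l (by omega) χ c
      push_cast
      calc _ ≤ _ := abs_sub_le _ (walsh (fun w => φ w c) χ (v l)) _
        _ ≤ _ := by linarith
  refine abs_sub_le_of_walsh (fun w => φ w c) (v 0) (by positivity) (fun χ hχ => ?_) g
  obtain ⟨l, hl⟩ := E.surjective (⟨χ, hχ⟩, c)
  have h1 := hsep l l.2
  simp only [hF, hl] at h1
  have h2 := (abs_walsh_le_of_sign_ne hm _ _ h1).trans (hstep l l.2 _ _)
  have h3 := hdist l l.2.le χ c
  have h4 : ((l : ℕ) : ℝ) + 1 ≤ k * 2 ^ a := by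
    refine le_trans ?_ hle
    exact_mod_cast l.2
  have h5 := abs_sub_abs_le_abs_sub (walsh (fun w => φ w c) χ (v 0))
    (walsh (fun w => φ w c) χ (v l))
  calc |walsh (fun w => φ w c) χ (v 0)| ≤ (((l : ℕ) : ℝ) + 1) * (2 ^ a * δ) := by linarith
    _ ≤ _ := by gcongr

end NearCoincidence

section SignedPath

open Finset

variable {m a k N : ℕ}

/-- Vertices of signed lattice paths of length `N`. -/
abbrev PVertex (a N : ℕ) := Fin a → Fin (N + 1) × ZMod 2

/-- Truncation of positions at `N`. -/
def clampVertex (N : ℕ) (w : Fin a → ℕ × ZMod 2) : PVertex a N :=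
  fun i => (⟨min (w i).1 N, by omega⟩, (w i).2)

/-- Changing signs of a vertex. -/
def signAct (g : Fin a → ZMod 2) (V : PVertex a N) : PVertex a N :=
  fun i => ((V i).1, (V i).2 + g i)

/-- Lattice paths with `d i` steps in direction `i`. -/
abbrev LatticePath (N : ℕ) (d : Fin a → ℕ) :=
  {y : Fin N → Fin a // ∀ i, (∑ s : Fin N, if y s = i then 1 else 0) = d i}

/-- Lattice paths together with signs. -/
abbrev SignedPath (N : ℕ) (d : Fin a → ℕ) := LatticePath N d × ((i : Fin a) → Fin (d i) → ZMod 2)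

/-- Number of steps in direction `i` before time `s`. -/
def prefixCount (y : Fin N → Fin a) (s : ℕ) (i : Fin a) : ℕ :=
  ∑ s' : Fin N, if y s' = i ∧ (s' : ℕ) < s then 1 else 0

/-- The vertex of a signed path at time `s`. -/
def pathVertex {d : Fin a → ℕ} (p : SignedPath N d) (s : ℕ) : PVertex a N :=
  clampVertex N fun i => (prefixCount p.1.1 s i, signAt p.2 i (prefixCount p.1.1 s i))

lemma prefixCount_le (y : Fin N → Fin a) (s : ℕ) (i : Fin a) : prefixCount y s i ≤ N := by
  refine (sum_le_sum (g := fun _ => 1) fun k _ => ?_).trans (by simp)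
  split_ifs <;> simp

lemma sum_prefixCount (y : Fin N → Fin a) {s : ℕ} (hs : s ≤ N) :
    ∑ i, prefixCount y s i = s := by
  unfold prefixCount
  rw [sum_comm]
  have : ∀ s' : Fin N, (∑ i, if y s' = i ∧ (s' : ℕ) < s then 1 else 0) =
      if (s' : ℕ) < s then 1 else 0 := by
    intro s'
    split_ifs with h <;> simp [h]
  simp only [this]
  rw [Fin.sum_univ_eq_sum_range (fun x => if x < s then 1 else 0) N, sum_boole]
  have e : (range N).filter (fun x => x < s) = range s := by
    ext x; simp; omega
  simp [e]

lemma signAct_pathVertex_inj {d : Fin a → ℕ} (p : SignedPath N d) {g g' : Fin a → ZMod 2}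
    {s s' : Fin (N + 1)}
    (h : signAct g (pathVertex p s) = signAct g' (pathVertex p s')) : g = g' ∧ s = s' := by
  have h1 : ∀ i, prefixCount p.1.1 s i = prefixCount p.1.1 s' i := by
    intro i
    have := congrArg (fun V : PVertex a N => ((V i).1 : ℕ)) h
    simpa [signAct, pathVertex, clampVertex, prefixCount_le] using this
  have h2 : s = s' := by
    have e1 := sum_prefixCount p.1.1 (Nat.lt_succ_iff.1 s.2)
    have e2 := sum_prefixCount p.1.1 (Nat.lt_succ_iff.1 s'.2)
    simp only [h1] at e1
    exact Fin.ext (e1.symm.trans e2)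
  subst h2
  refine ⟨funext fun i => ?_, rfl⟩
  have := congrArg (fun V : PVertex a N => (V i).2) h
  simpa [signAct] using this

lemma exists_threshold {N : ℕ} (P : Fin N → Prop) (hP : ∀ s s', s ≤ s' → P s' → P s) :
    ∃ q ≤ N, ∀ s : Fin N, P s ↔ (s : ℕ) < q := by
  classical
  have hex : ∃ q, ∀ h : q < N, ¬ P ⟨q, h⟩ := ⟨N, fun h => absurd h (lt_irrefl _)⟩
  refine ⟨Nat.find hex, Nat.find_min' hex fun h => absurd h (lt_irrefl _), fun s => ?_⟩
  constructor
  · intro hs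
    by_contra hlt
    push Not at hlt
    have h1 : Nat.find hex < N := hlt.trans_lt s.2
    exact Nat.find_spec hex h1 (hP _ _ (Fin.le_def.2 hlt) hs)
  · intro hs
    have := Nat.find_min hex hs
    push Not at this
    exact this.2

/-- The slots of the initial vertex of a word lie on a signed path. -/
lemma exists_path_of_word {d : Fin a → ℕ} {u : Fin N → Fin m × Fin a} (hu : u ∈ words m N d) :
    ∃ y : LatticePath N d, ∀ t, ∃ s : Fin (N + 1), ∀ i,
      posCount u 0 t i = prefixCount y.1 s i := by
  let τ := Tuple.sort fun l => (u l).1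
  have hτ : Monotone fun l => (u (τ l)).1 := Tuple.monotone_sort fun l => (u l).1
  refine ⟨⟨fun s => (u (τ s)).2, fun i => ?_⟩, fun t => ?_⟩
  · rw [← mem_words.1 hu i]
    exact Equiv.sum_comp τ fun l => if (u l).2 = i then 1 else 0
  · obtain ⟨q, hq, h⟩ := exists_threshold (fun l => (u (τ l)).1 ≤ t)
      fun s s' hs h => (hτ hs).trans h
    refine ⟨⟨q, by omega⟩, fun i => ?_⟩
    unfold posCount prefixCount
    rw [← Equiv.sum_comp τ]
    refine sum_congr rfl fun l _ => ?_
    simp only [← h, Nat.zero_le, and_true, ← le_iff_lt_or_eq]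

open Classical in
/-- The push-forward of weights on a signed path translated by `g`. -/
noncomputable def pushWeight {d : Fin a → ℕ} (p : SignedPath N d) (g : Fin a → ZMod 2)
    (w : Fin (N + 1) → ℝ) (V : PVertex a N) : ℝ :=
  ∑ s : Fin (N + 1), if signAct g (pathVertex p s) = V then w s else 0

lemma pushWeight_apply {d : Fin a → ℕ} (p : SignedPath N d) (g : Fin a → ZMod 2)
    (w : Fin (N + 1) → ℝ) (s : Fin (N + 1)) :
    pushWeight p g w (signAct g (pathVertex p s)) = w s := by
  unfold pushWeight
  rw [sum_eq_single s]
  · simp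
  · intro s' _ hs'
    rw [if_neg fun h => hs' (signAct_pathVertex_inj p h).2]
  · simp

lemma pushWeight_eq_zero {d : Fin a → ℕ} (p : SignedPath N d) (g : Fin a → ZMod 2)
    (w : Fin (N + 1) → ℝ) {V : PVertex a N} (h : ∀ s : Fin (N + 1), signAct g (pathVertex p s) ≠ V) :
    pushWeight p g w V = 0 :=
  sum_eq_zero fun s _ => if_neg (h s)

open Classical in
/-- The empirical distribution of the slots of a vertex. -/
noncomputable def empirical (N : ℕ) (w : SVertex m a) (V : PVertex a N) : ℝ :=
  (∑ t, if clampVertex N (w t) = V then 1 else 0) / m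

lemma empirical_mem (w : SVertex m a) (V : PVertex a N) : empirical N w V ∈ Set.Icc (0 : ℝ) 1 := by
  unfold empirical
  refine ⟨div_nonneg (sum_nonneg fun _ _ => by split_ifs <;> simp) (Nat.cast_nonneg _), ?_⟩
  refine div_le_one_of_le₀ ?_ (Nat.cast_nonneg _)
  refine (sum_le_sum (g := fun _ => 1) fun k _ => ?_).trans (by simp)
  split_ifs <;> simp

lemma abs_empirical_sub_le {w w' : SVertex m a} {t : Fin m} (h : ∀ t' ≠ t, w t' = w' t')
    (V : PVertex a N) : |empirical N w V - empirical N w' V| ≤ 1 / m := by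
  unfold empirical
  rw [← sub_div, abs_div, Nat.abs_cast, ← sum_sub_distrib]
  gcongr
  rw [sum_eq_single t]
  · split_ifs <;> simp
  · intro t' _ ht'
    rw [h t' ht', sub_self]
  · simp

/-- Continuous Borsuk–Ulam type statement: on some signed path there is a distribution whose
translates have nearly the same image. -/
theorem exists_weight_near_coincidence (hN : N = k * (2 ^ a - 1)) (ha : 0 < a) (hk : 0 < k)
    (Φ : (PVertex a N → ℝ) → Fin k → ℝ)
    (hΦ : ContinuousOn Φ (Set.pi Set.univ fun _ => Set.Icc 0 1)) {δ : ℝ} (hδ : 0 < δ) :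
    ∃ (p : SignedPath N (topCount a k)) (w : Fin (N + 1) → ℝ),
      (∀ s, 0 ≤ w s) ∧ ∑ s, w s = 1 ∧
      ∀ g c, |Φ (pushWeight p g w) c - Φ (pushWeight p 0 w) c| ≤ δ := by
  classical
  have hcomp : IsCompact (Set.pi Set.univ fun _ : PVertex a N => Set.Icc (0 : ℝ) 1) :=
    isCompact_univ_pi fun _ => isCompact_Icc
  have huc := Metric.uniformContinuousOn_iff_le.1 (hcomp.uniformContinuousOn_of_continuous hΦ)
  set C : ℝ := 2 * ((k * 2 ^ a) * 2 ^ a)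
  have hC : 0 < C := by
    have : (0 : ℝ) < k := by exact_mod_cast hk
    positivity
  obtain ⟨ρ, hρ, huc⟩ := huc (δ / C) (by positivity)
  obtain ⟨m, hm⟩ := exists_nat_gt (1 / ρ)
  have hm0 : 0 < (m : ℝ) := lt_trans (by positivity) hm
  have hm' : 0 < m := by exact_mod_cast hm0
  have hmρ : 1 / (m : ℝ) ≤ ρ := by
    rw [div_le_iff₀ hm0]
    rw [div_lt_iff₀ hρ] at hm
    linarith
  obtain ⟨u, hu, e, hnear⟩ := exists_near_coincidence hN ha hk hm'
    (fun w => Φ (empirical N w)) (δ := δ / C) (by positivity) (by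
      intro w w' t h c
      have := huc (empirical N w) (fun V _ => empirical_mem w V) (empirical N w')
        (fun V _ => empirical_mem w' V) ((dist_pi_le_iff hρ.le).2 fun V =>
          (abs_empirical_sub_le h V).trans hmρ)
      exact (dist_le_pi_dist _ _ c).trans this)
  obtain ⟨y, hy⟩ := exists_path_of_word hu
  choose q hq using hy
  have hemp : ∀ g, empirical N (signShift g (wordVertex u e 0)) =
      pushWeight (y, e) g fun s => (∑ t, if q t = s then 1 else 0) / m := by
    intro g
    funext V
    have h1 : ∀ t, clampVertex N (signShift g (wordVertex u e 0) t) =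
        signAct g (pathVertex (y, e) (q t)) := by
      intro t
      funext i
      simp [signAct, pathVertex, clampVertex, signShift, wordVertex, hq]
    simp only [empirical, pushWeight, h1]
    rw [sum_div]
    simp only [sum_div, ← sum_filter]
    rw [sum_comm' (t' := univ) (s' := fun t => if signAct g (pathVertex (y, e) (q t)) = V then {q t} else ∅)]
    · refine sum_congr rfl fun t _ => ?_
      split_ifs with h <;> simp
    · intro s t
      constructor
      · rintro ⟨h1, h2⟩
        simp only [mem_filter, mem_univ, true_and] at h1 h2
        subst h2
        simp [h1]
      · rintro ⟨h1, -⟩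
        split_ifs at h1 with h
        · rw [mem_singleton] at h1
          subst h1
          simp [h]
        · simp at h1
  refine ⟨(y, e), fun s => (∑ t, if q t = s then 1 else 0) / m,
    fun s => div_nonneg (sum_nonneg fun _ _ => by split_ifs <;> simp) hm0.le, ?_, fun g c => ?_⟩
  · rw [← sum_div, sum_comm]
    simp [hm0.ne']
  · have h1 := hnear g c
    rw [hemp] at h1
    have h2 := hemp 0
    rw [signShift_zero] at h2
    rw [h2] at h1
    refine h1.trans (le_of_eq ?_)
    simp only [C]
    field_simp

lemma card_latticePath_mul_le (d : Fin a → ℕ) (f : Fin a → ℕ) :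
    Fintype.card (LatticePath N d) * ∏ i, f i ^ d i ≤ (∑ i, f i) ^ N := by
  classical
  rw [Fintype.sum_pow, Fintype.card_subtype, ← smul_eq_mul, ← sum_const]
  refine le_trans (le_of_eq ?_) (sum_le_sum_of_subset (filter_subset
    (fun y : Fin N → Fin a => ∀ i, (∑ s : Fin N, if y s = i then 1 else 0) = d i) _))
  refine sum_congr rfl fun y hy => ?_
  rw [mem_filter] at hy
  simp only [← hy.2, ← prod_pow_eq_pow_sum]
  rw [Finset.prod_comm]
  refine prod_congr rfl fun s _ => ?_
  simp [pow_ite]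

lemma sum_topCount (a k : ℕ) : ∑ i, topCount a k i = k * (2 ^ a - 1) := by
  classical
  simp only [topCount, ← mul_sum, card_filter]
  rw [sum_comm]
  have : ∀ χ : Fin a → ZMod 2, (∑ i, if HasTopIndex χ i then 1 else 0) = if χ ≠ 0 then 1 else 0 := by
    intro χ
    split_ifs with h
    · obtain ⟨i, hi⟩ := exists_hasTopIndex h
      rw [sum_eq_single i, if_pos hi]
      · intro j _ hj
        exact if_neg fun hj' => hj (hj'.unique hi)
      · simp
    · exact sum_eq_zero fun i _ => if_neg fun hi => h hi.ne_zero
  simp only [this, ← card_filter]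
  rw [filter_not, card_sdiff_of_subset (filter_subset _ _)]
  simp [ZMod.card, filter_eq']

lemma card_vanishing_above (j : Fin a) :
    #{χ : Fin a → ZMod 2 | ∀ j', j < j' → χ j' = 0} = 2 ^ ((j : ℕ) + 1) := by
  classical
  have : ({χ : Fin a → ZMod 2 | ∀ j', j < j' → χ j' = 0} : Finset _) =
      Fintype.piFinset fun i => if i ≤ j then univ else {0} := by
    ext χ
    simp only [mem_filter, mem_univ, true_and, Fintype.mem_piFinset]
    refine forall_congr' fun i => ?_
    by_cases h : i ≤ j
    · simp [h, not_lt.2 h]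
    · simp [h, not_le.1 h]
  rw [this, Fintype.card_piFinset]
  have h2 : ∀ i, #(if i ≤ j then (univ : Finset (ZMod 2)) else {0}) = if i ≤ j then 2 else 1 := by
    intro i; split_ifs <;> simp [ZMod.card]
  simp only [h2, prod_ite, prod_const, one_pow, mul_one]
  congr 1
  rw [← Fin.card_Iic]
  congr 1
  ext i; simp

lemma sum_topCount_mul_le (a k : ℕ) : ∑ i : Fin a, (a - i) * topCount a k i ≤ 2 * (k * 2 ^ a) := by
  classical
  have h1 : ∀ i : Fin a, a - (i : ℕ) = ∑ j : Fin a, if i ≤ j then 1 else 0 := by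
    intro i
    rw [← card_filter, ← Fin.card_Ici]
    congr 1
    ext j; simp
  have h2 : ∑ i : Fin a, (a - i) * #{χ : Fin a → ZMod 2 | HasTopIndex χ i} ≤
      ∑ j : Fin a, 2 ^ ((j : ℕ) + 1) := by
    simp only [h1, sum_mul]
    rw [sum_comm]
    refine sum_le_sum fun j _ => ?_
    rw [← card_vanishing_above j]
    simp only [card_filter, mul_sum]
    rw [sum_comm]
    refine sum_le_sum fun χ _ => ?_
    by_cases h : ∃ i, HasTopIndex χ i
    · obtain ⟨i, hi⟩ := h
      rw [sum_eq_single i]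
      · rw [if_pos hi, mul_one]
        by_cases h3 : i ≤ j
        · rw [if_pos h3, if_pos fun j' hj' => hi.2 j' (h3.trans_lt hj')]
        · simp [h3]
      · intro i' _ hi'
        rw [if_neg (fun h : HasTopIndex χ i' => hi' (h.unique hi)), mul_zero]
      · simp
    · push Not at h
      simp [h]
  have h3 : ∑ j : Fin a, 2 ^ ((j : ℕ) + 1) ≤ 2 * 2 ^ a := by
    rw [Fin.sum_univ_eq_sum_range (fun j => 2 ^ (j + 1)) a]
    simp only [pow_succ, ← sum_mul]
    have := Nat.geomSum_lt (m := 2) (n := a) (s := range a) le_rfl (by simp)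
    omega
  calc ∑ i : Fin a, (a - i) * topCount a k i
      = k * ∑ i : Fin a, (a - i) * #{χ : Fin a → ZMod 2 | HasTopIndex χ i} := by
        rw [mul_sum]; refine sum_congr rfl fun i _ => ?_
        rw [topCount]; ring
    _ ≤ k * (2 * 2 ^ a) := Nat.mul_le_mul_left _ (h2.trans h3)
    _ = _ := by ring

lemma card_latticePath_le (a k : ℕ) :
    Fintype.card (LatticePath (k * (2 ^ a - 1)) (topCount a k)) ≤ 4 ^ (k * 2 ^ a) := by
  have h1 := card_latticePath_mul_le (N := k * (2 ^ a - 1)) (topCount a k) fun i => 2 ^ (i : ℕ)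
  have h2 : ∑ i : Fin a, 2 ^ (i : ℕ) ≤ 2 ^ a := by
    rw [Fin.sum_univ_eq_sum_range (fun j => 2 ^ j) a]
    exact (Nat.geomSum_lt (m := 2) (n := a) (s := range a) le_rfl (by simp)).le
  have h3 : (2 ^ a) ^ (k * (2 ^ a - 1)) = (∏ i : Fin a, (2 ^ (i : ℕ)) ^ topCount a k i) *
      2 ^ ∑ i : Fin a, (a - i) * topCount a k i := by
    rw [← sum_topCount, ← prod_pow_eq_pow_sum, ← prod_pow_eq_pow_sum, ← prod_mul_distrib]
    refine prod_congr rfl fun i _ => ?_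
    rw [pow_mul 2 (a - (i : ℕ)), ← mul_pow, ← pow_add]
    congr 2
    omega
  have h4 := h1.trans (Nat.pow_le_pow_left h2 _)
  rw [h3, mul_comm] at h4
  refine (Nat.le_of_mul_le_mul_left h4 (prod_pos fun i _ => by positivity)).trans ?_
  rw [show 4 = 2 ^ 2 by norm_num, ← pow_mul]
  exact Nat.pow_le_pow_right (by norm_num) (sum_topCount_mul_le a k)

end SignedPath

section Counting

open Finset

open Classical in
/-- Colorings prescribed, off a set `I`, along an injection. -/
lemma card_prescribed_mul_le {X K : Type*} [Fintype X] [Fintype K] {q : ℕ}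
    (I : Finset X) {φ : X → K} (hφ : Function.Injective φ) (b : X → Fin q) :
    #{c : K → Fin q | ∀ x ∉ I, c (φ x) = b x} * q ^ Fintype.card X ≤
      q ^ Fintype.card K * q ^ #I := by
  have hsub : ({c : K → Fin q | ∀ x ∉ I, c (φ x) = b x} : Finset _) ⊆
      Fintype.piFinset fun κ => if h : ∃ x ∉ I, φ x = κ then {b h.choose} else univ := by
    intro c hc
    rw [mem_filter] at hc
    rw [Fintype.mem_piFinset]
    intro κ
    split_ifs with h
    · rw [mem_singleton, ← hc.2 _ h.choose_spec.1, h.choose_spec.2]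
    · exact mem_univ _
  have hcard : ∀ κ, #(if h : ∃ x ∉ I, φ x = κ then {b h.choose} else (univ : Finset (Fin q))) =
      if κ ∈ Iᶜ.image φ then 1 else q := by
    intro κ
    by_cases h : ∃ x ∉ I, φ x = κ
    · rw [dif_pos h, if_pos (by simpa using h), card_singleton]
    · rw [dif_neg h, if_neg (by simpa using h), card_univ, Fintype.card_fin]
  have h1 := card_le_card hsub
  rw [Fintype.card_piFinset] at h1
  simp only [hcard] at h1
  rw [prod_ite, prod_const_one, one_mul, prod_const] at h1
  have h2 : #{κ | κ ∉ Iᶜ.image φ} + Fintype.card X = Fintype.card K + #I := by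
    have e1 : ({κ | κ ∉ Iᶜ.image φ} : Finset K) = (Iᶜ.image φ)ᶜ := by ext; simp
    have e2 := card_compl_add_card (Iᶜ.image φ)
    rw [card_image_of_injective _ hφ] at e2
    have e3 := card_compl_add_card I
    rw [e1]
    omega
  calc _ ≤ q ^ #{κ | κ ∉ Iᶜ.image φ} * q ^ Fintype.card X := Nat.mul_le_mul_right _ h1
    _ = _ := by rw [← pow_add, h2, pow_add]

/-- A union bound: if every coloring is prescribed by one of finitely many patterns, off at most
`N` points, then there are many patterns. -/
lemma pow_card_le_card_mul {X K P : Type*} [Fintype X] [Fintype K] [Fintype P] {q N : ℕ}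
    (hq : 0 < q) (I : P → Finset X) (φ : P → X → K) (hφ : ∀ p, Function.Injective (φ p))
    (b : P → X → Fin q)
    (h : ∀ c : K → Fin q, ∃ p, #(I p) ≤ N ∧ ∀ x ∉ I p, c (φ p x) = b p x) :
    q ^ Fintype.card X ≤ Fintype.card P * q ^ N := by
  classical
  have h1 : q ^ Fintype.card K ≤ ∑ p with #(I p) ≤ N,
      #{c : K → Fin q | ∀ x ∉ I p, c (φ p x) = b p x} := by
    refine le_trans ?_ card_biUnion_le
    have e : q ^ Fintype.card K = #(univ : Finset (K → Fin q)) := by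
      rw [card_univ, Fintype.card_fun, Fintype.card_fin]
    rw [e]
    refine card_le_card fun c _ => ?_
    obtain ⟨p, hp, hc⟩ := h c
    exact mem_biUnion.2 ⟨p, by simpa using hp, by simpa using hc⟩
  refine le_of_mul_le_mul_left ?_ (pow_pos hq (Fintype.card K))
  calc q ^ Fintype.card K * q ^ Fintype.card X
      ≤ (∑ p with #(I p) ≤ N, #{c : K → Fin q | ∀ x ∉ I p, c (φ p x) = b p x}) *
        q ^ Fintype.card X := Nat.mul_le_mul_right _ h1
    _ ≤ ∑ p : P with #(I p) ≤ N, q ^ Fintype.card K * q ^ N := by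
        rw [sum_mul]
        refine sum_le_sum fun p hp => (card_prescribed_mul_le (I p) (hφ p) (b p)).trans ?_
        exact Nat.mul_le_mul_left _ (Nat.pow_le_pow_right hq (mem_filter.1 hp).2)
    _ ≤ Fintype.card P * (q ^ Fintype.card K * q ^ N) := by
        rw [sum_const, smul_eq_mul]
        exact Nat.mul_le_mul_right _ (card_le_univ _)
    _ = _ := by ring

/-- An arrangement with prescribed multiset of values maximizing `∑ x, H x (f x)`. -/
lemma exists_optimal_arrangement {X S : Type*} [Fintype X] [Fintype S] (H : X → S → ℝ) :
    ∃ F : Sym S (Fintype.card X) → X → S, ∀ (w : S → ℝ) (f : X → S),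
      (∀ x s, w s + H x s ≤ w (f x) + H x (f x)) →
      ∃ t, ∀ x, (∀ s ≠ f x, w s + H x s < w (f x) + H x (f x)) → F t x = f x := by
  classical
  let val : (X → S) → Multiset S := fun f => univ.val.map f
  have hval : ∀ f, Multiset.card (val f) = Fintype.card X := by intro f; simp [val]
  have key : ∀ t : Sym S (Fintype.card X), ∃ f₀ : Option (X → S), ∀ f, val f = t →
      ∃ f₁, f₀ = some f₁ ∧ val f₁ = t ∧ ∑ x, H x (f x) ≤ ∑ x, H x (f₁ x) := by
    intro t
    by_cases hne : ({f | val f = t} : Finset (X → S)).Nonempty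
    · obtain ⟨f₁, h1, h2⟩ := exists_max_image _ (fun f => ∑ x, H x (f x)) hne
      refine ⟨some f₁, fun f hf => ⟨f₁, rfl, by simpa using h1, h2 f (by simpa using hf)⟩⟩
    · exact ⟨none, fun f hf => absurd ⟨f, by simpa using hf⟩ hne⟩
  choose F₀ hF₀ using key
  by_cases hS : Nonempty (X → S)
  swap
  · exact ⟨fun t => (hS ⟨fun x => (t.1.toList.get ⟨0, by
      rw [Multiset.length_toList, t.2]; exact Fintype.card_pos_iff.2 ⟨x⟩⟩)⟩).elim,
      fun w f => (hS ⟨f⟩).elim⟩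
  obtain ⟨f'⟩ := hS
  refine ⟨fun t => (F₀ t).getD f', fun w f hf => ⟨Sym.mk (val f) (hval f), fun x hx => ?_⟩⟩
  obtain ⟨f₁, h1, h2, h3⟩ := hF₀ (Sym.mk (val f) (hval f)) f rfl
  simp only [h1, Option.getD_some]
  replace h2 : val f₁ = val f := h2
  have h4 : ∑ x, w (f₁ x) = ∑ x, w (f x) := by
    have := congrArg (fun t : Multiset S => (t.map w).sum) h2
    simpa [val] using this
  have h5 : ∀ x ∈ univ, w (f₁ x) + H x (f₁ x) ≤ w (f x) + H x (f x) := fun x _ => hf x _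
  have h6 := (sum_eq_sum_iff_of_le h5).1 (le_antisymm (sum_le_sum h5) (by
    rw [sum_add_distrib, sum_add_distrib, h4]; gcongr))
  by_contra hne
  exact (hx _ hne).ne (h6 x (mem_univ x))

end Counting

section Genericity

open Finset

lemma exists_dependency {N : ℕ} {E : Type*} [Fintype E] (hE : N < Fintype.card E)
    (s s' : E → Fin (N + 1)) :
    ∃ μ : E → ℝ, μ ≠ 0 ∧ ∀ w : Fin (N + 1) → ℝ, ∑ e, μ e * (w (s e) - w (s' e)) = 0 := by
  classical
  let f : (E → ℝ) →ₗ[ℝ] (Fin N → ℝ) :=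
    { toFun := fun μ t => ∑ e, μ e *
        ((if s e = t.succ then 1 else 0) - (if s' e = t.succ then 1 else 0))
      map_add' := fun μ ν => by ext t; simp [add_mul, sum_add_distrib]
      map_smul' := fun r μ => by ext t; simp [mul_sum, mul_assoc] }
  obtain ⟨μ, hμ, hμ0⟩ := (Submodule.ne_bot_iff _).1
    (LinearMap.ker_ne_bot_of_finrank_lt (f := f) (by simpa using hE))
  refine ⟨μ, hμ0, fun w => ?_⟩
  have h1 : ∀ t : Fin N, ∑ e, μ e *
      ((if s e = t.succ then 1 else 0) - (if s' e = t.succ then 1 else 0)) = 0 :=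
    fun t => congrFun hμ t
  have h2 : ∀ x : Fin (N + 1), w x = w 0 + ∑ t : Fin N,
      (if x = t.succ then 1 else 0) * (w t.succ - w 0) := by
    intro x
    refine Fin.cases ?_ (fun j => ?_) x
    · simp [(Fin.succ_ne_zero _).symm]
    · simp
  calc ∑ e, μ e * (w (s e) - w (s' e))
      = ∑ e, ∑ t : Fin N, (μ e * ((if s e = t.succ then 1 else 0) -
          (if s' e = t.succ then 1 else 0))) * (w t.succ - w 0) := by
        refine sum_congr rfl fun e _ => ?_
        rw [h2 (s e), h2 (s' e), add_sub_add_left_eq_sub, ← sum_sub_distrib, mul_sum]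
        exact sum_congr rfl fun t _ => by ring
    _ = 0 := by
        rw [sum_comm]
        simp only [← sum_mul, h1, zero_mul, sum_const_zero]

open Classical in
/-- For a generic perturbation `h`, along finitely many injective patterns, there are at most `N`
near ties. -/
lemma exists_generic_perturbation {N : ℕ} {P X K : Type*} [Finite P] [Fintype X] [Fintype K]
    (φ : P → X → Fin (N + 1) → K)
    (hφ : ∀ p x x' s s', φ p x s = φ p x' s' → x = x' ∧ s = s') {η : ℝ} (hη : 0 < η) :
    ∃ (h : K → ℝ) (τ : ℝ), (∀ κ, |h κ| ≤ η) ∧ 0 < τ ∧ τ ≤ η ∧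
      ∀ (p : P) (w : Fin (N + 1) → ℝ),
        #{x | ∃ s s', s ≠ s' ∧ |(w s + h (φ p x s)) - (w s' + h (φ p x s'))| ≤ τ} ≤ N := by
  let Conf := {q : P × (Fin (N + 1) ↪ X) × (Fin (N + 1) → Fin (N + 1)) × (Fin (N + 1) → Fin (N + 1)) //
    ∀ e, q.2.2.1 e ≠ q.2.2.2 e}
  have hdep := fun q : Conf => exists_dependency (E := Fin (N + 1)) (by simp) q.1.2.2.1 q.1.2.2.2
  choose μ hμ0 hμ using hdep
  let F : Conf → Module.Dual ℝ (K → ℝ) := fun q =>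
    ∑ e, μ q e • ((LinearMap.proj (φ q.1.1 (q.1.2.1 e) (q.1.2.2.1 e)) : (K → ℝ) →ₗ[ℝ] ℝ) -
      LinearMap.proj (φ q.1.1 (q.1.2.1 e) (q.1.2.2.2 e)))
  have hF : ∀ q h, F q h = ∑ e, μ q e *
      (h (φ q.1.1 (q.1.2.1 e) (q.1.2.2.1 e)) - h (φ q.1.1 (q.1.2.1 e) (q.1.2.2.2 e))) := by
    intro q h
    simp [F, LinearMap.sum_apply]
  obtain ⟨h₀, hh₀⟩ := Module.Dual.exists_forall_ne_zero_of_forall_exists F (by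
    intro q
    obtain ⟨e₀, he₀⟩ := Function.ne_iff.1 (hμ0 q)
    refine ⟨Pi.single (φ q.1.1 (q.1.2.1 e₀) (q.1.2.2.1 e₀)) 1, ?_⟩
    rw [hF, sum_eq_single e₀]
    · rw [Pi.single_eq_same, Pi.single_eq_of_ne, sub_zero, mul_one]
      · exact he₀
      · exact fun h => q.2 e₀ (hφ _ _ _ _ _ h).2.symm
    · intro e _ he
      rw [Pi.single_eq_of_ne, Pi.single_eq_of_ne, sub_zero, mul_zero]
      · exact fun h => he (q.1.2.1.injective (hφ _ _ _ _ _ h).1)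
      · exact fun h => he (q.1.2.1.injective (hφ _ _ _ _ _ h).1)
    · simp)
  have hscale : ∃ c : ℝ, 0 < c ∧ ∀ κ, |c * h₀ κ| ≤ η := by
    have h1 : 0 < 1 + ∑ κ, |h₀ κ| := by positivity
    refine ⟨η / (1 + ∑ κ, |h₀ κ|), by positivity, fun κ => ?_⟩
    rw [abs_mul, abs_of_pos (by positivity), div_mul_eq_mul_div, div_le_iff₀ h1]
    gcongr
    linarith [single_le_sum (f := fun κ => |h₀ κ|) (fun κ _ => abs_nonneg _) (mem_univ κ)]
  obtain ⟨c, hc, hcη⟩ := hscale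
  have hne : ∀ q, F q (c • h₀) ≠ 0 := fun q => by
    rw [map_smul]; exact smul_ne_zero hc.ne' (hh₀ q)
  have hτ : ∃ τ : ℝ, 0 < τ ∧ τ ≤ η ∧ ∀ q, τ * ∑ e, |μ q e| < |F q (c • h₀)| := by
    have h1 : ∀ q, ∀ᶠ τ in nhdsWithin (0 : ℝ) (Set.Ioi 0), τ * ∑ e, |μ q e| < |F q (c • h₀)| := by
      intro q
      have : Filter.Tendsto (fun τ : ℝ => τ * ∑ e, |μ q e|) (nhds 0) (nhds (0 * ∑ e, |μ q e|)) :=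
        Filter.tendsto_id.mul_const _
      rw [zero_mul] at this
      exact (this.eventually_lt_const (abs_pos.2 (hne q))).filter_mono nhdsWithin_le_nhds
    have h2 : ∀ᶠ τ in nhdsWithin (0 : ℝ) (Set.Ioi 0), τ ∈ Set.Ioc 0 η :=
      Ioc_mem_nhdsGT hη
    obtain ⟨τ, h3, h4⟩ := ((Filter.eventually_all.2 h1).and h2).exists
    exact ⟨τ, h4.1, h4.2, h3⟩
  obtain ⟨τ, hτ0, hτη, hτ⟩ := hτ
  refine ⟨c • h₀, τ, fun κ => hcη κ, hτ0, hτη, fun p w => ?_⟩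
  by_contra hlt
  push Not at hlt
  obtain ⟨ι, hι⟩ : ∃ ι : Fin (N + 1) ↪ X, ∀ e, ι e ∈ ({x | ∃ s s', s ≠ s' ∧
      |(w s + (c • h₀) (φ p x s)) - (w s' + (c • h₀) (φ p x s'))| ≤ τ} : Finset X) := by
    obtain ⟨A, hA, hAc⟩ := exists_subset_card_eq (Nat.succ_le_of_lt hlt)
    exact ⟨(A.equivFinOfCardEq hAc).symm.toEmbedding.trans (Function.Embedding.subtype _),
      fun e => hA ((A.equivFinOfCardEq hAc).symm e).2⟩
  simp only [mem_filter, mem_univ, true_and] at hι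
  choose s s' hss hs using hι
  have h1 := hτ ⟨(p, ι, s, s'), hss⟩
  have h2 := hμ ⟨(p, ι, s, s'), hss⟩ w
  rw [hF] at h1
  refine absurd h1 (not_lt.2 ?_)
  rw [← add_zero (∑ e, _), ← h2, ← sum_add_distrib, mul_sum]
  refine (abs_sum_le_sum_abs _ _).trans (sum_le_sum fun e _ => ?_)
  rw [← mul_add, abs_mul, mul_comm τ]
  refine mul_le_mul_of_nonneg_left ?_ (abs_nonneg _)
  refine le_trans (le_of_eq (congrArg _ ?_)) (hs e)
  dsimp only
  ring

end Genericity

section SoftChoice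

open Finset

variable {V : Type*} [Fintype V] [Nonempty V]

/-- The average of `v` over the near maximizers of `u`. -/
noncomputable def softChoice (τ : ℝ) (v u : V → ℝ) : ℝ :=
  (∑ x, max 0 (u x - univ.sup' univ_nonempty u + τ) * v x) /
    ∑ x, max 0 (u x - univ.sup' univ_nonempty u + τ)

lemma sum_softWeight_pos {τ : ℝ} (hτ : 0 < τ) (u : V → ℝ) :
    0 < ∑ x, max 0 (u x - univ.sup' univ_nonempty u + τ) := by
  obtain ⟨x, -, hx⟩ := exists_mem_eq_sup' univ_nonempty u
  refine sum_pos' (fun _ _ => le_max_left _ _) ⟨x, mem_univ x, lt_max_of_lt_right ?_⟩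
  rw [hx]
  linarith

lemma continuous_softChoice {τ : ℝ} (hτ : 0 < τ) (v : V → ℝ) : Continuous (softChoice τ v) := by
  have h1 : Continuous fun u : V → ℝ => univ.sup' univ_nonempty u :=
    Continuous.finset_sup'_apply univ_nonempty fun i _ => continuous_apply i
  unfold softChoice
  refine Continuous.div ?_ ?_ fun u => (sum_softWeight_pos hτ u).ne'
  all_goals fun_prop

lemma softChoice_mem {τ : ℝ} (hτ : 0 < τ) {v : V → ℝ} (hv : ∀ x, v x ∈ unitInterval) (u : V → ℝ) :
    softChoice τ v u ∈ unitInterval := by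
  have h := sum_softWeight_pos hτ u
  refine ⟨div_nonneg (sum_nonneg fun x _ => mul_nonneg (le_max_left _ _) (hv x).1) h.le, ?_⟩
  refine div_le_one_of_le₀ (sum_le_sum fun x _ => ?_) h.le
  exact mul_le_of_le_one_right (le_max_left _ _) (hv x).2

lemma softChoice_eq {τ : ℝ} (hτ : 0 < τ) (v : V → ℝ) {u : V → ℝ} {x₀ : V}
    (h : ∀ x ≠ x₀, u x ≤ u x₀ - τ) : softChoice τ v u = v x₀ := by
  have h1 : univ.sup' univ_nonempty u = u x₀ := by
    refine le_antisymm (sup'_le _ _ fun x _ => ?_) (le_sup' u (mem_univ x₀))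
    by_cases hx : x = x₀
    · rw [hx]
    · linarith [h x hx]
  have h2 : ∀ x ≠ x₀, max 0 (u x - u x₀ + τ) = 0 := fun x hx =>
    max_eq_left (by linarith [h x hx])
  unfold softChoice
  rw [h1, sum_eq_single x₀ (fun x _ hx => by rw [h2 x hx, zero_mul]) (by simp),
    sum_eq_single x₀ (fun x _ hx => h2 x hx) (by simp), mul_div_assoc, sub_self, zero_add,
    max_eq_right hτ.le, mul_div_cancel₀ _ hτ.ne']

end SoftChoice

section Waist

open Finset

variable {a k N : ℕ}

lemma card_signedPath (a k : ℕ) :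
    Fintype.card (SignedPath (k * (2 ^ a - 1)) (topCount a k)) ≤
      4 ^ (k * 2 ^ a) * 2 ^ (k * (2 ^ a - 1)) := by
  rw [Fintype.card_prod]
  refine Nat.mul_le_mul (card_latticePath_le a k) (le_of_eq ?_)
  rw [Fintype.card_pi]
  simp only [Fintype.card_fun, ZMod.card, Fintype.card_fin]
  rw [prod_pow_eq_pow_sum, sum_topCount]

/-- At a translate of a distribution on a signed path, the near maximum is attained only once
unless there is a near tie along the path. -/
lemma le_sub_of_no_tie {d : Fin a → ℕ} (p : SignedPath N d) (g : Fin a → ZMod 2)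
    {w : Fin (N + 1) → ℝ} (hw : ∑ s, w s = 1) {h : PVertex a N → ℝ} {η τ : ℝ}
    (hη : 2 * η + τ ≤ 1 / (N + 1)) (hh : ∀ V, |h V| ≤ η) {s₀ : Fin (N + 1)}
    (hmax : ∀ s, w s + h (signAct g (pathVertex p s)) ≤ w s₀ + h (signAct g (pathVertex p s₀)))
    (htie : ∀ s ≠ s₀, τ < |(w s₀ + h (signAct g (pathVertex p s₀))) -
      (w s + h (signAct g (pathVertex p s)))|) :
    ∀ V ≠ signAct g (pathVertex p s₀), pushWeight p g w V + h V ≤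
      pushWeight p g w (signAct g (pathVertex p s₀)) + h (signAct g (pathVertex p s₀)) - τ := by
  intro V hV
  rw [pushWeight_apply]
  by_cases hs : ∃ s : Fin (N + 1), signAct g (pathVertex p s) = V
  · obtain ⟨s, rfl⟩ := hs
    have h1 := htie s fun h => hV (by rw [h])
    rw [abs_of_nonneg (sub_nonneg.2 (hmax s))] at h1
    rw [pushWeight_apply]
    linarith
  · push Not at hs
    rw [pushWeight_eq_zero p g w hs, zero_add]
    obtain ⟨s, -, hs1⟩ := exists_le_of_sum_le (s := univ) (f := fun _ : Fin (N + 1) => 1 / ((N : ℝ) + 1))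
      (g := w) univ_nonempty (by
        rw [hw, sum_const, card_univ, Fintype.card_fin, nsmul_eq_mul]
        push_cast
        rw [mul_one_div_cancel (by positivity)])
    have h1 := hmax s
    have h2 := abs_le.1 (hh V)
    have h3 := abs_le.1 (hh (signAct g (pathVertex p s)))
    linarith

lemma card_sym_le (N m : ℕ) : Fintype.card (Sym (Fin (N + 1)) m) ≤ 2 ^ (N + m) := by
  rw [Sym.card_sym_eq_choose, Fintype.card_fin]
  refine (Nat.choose_le_two_pow _ _).trans (Nat.pow_le_pow_right (by norm_num) (by omega))

/-- A waist inequality for cubes in terms of labels: if the fibers of a continuous map to `ℝᵏ`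
carry few label patterns, then there are not too many labels. -/
theorem waist_inequality {J : Type*} [Fintype J] {k L q : ℕ} (hk : 0 < k) (hq : 0 < q)
    (val : Fin q → unitInterval) (lab : unitInterval → Fin q) (hlab : ∀ c, lab (val c) = c)
    {F : (J → unitInterval) → Fin k → ℝ} (hF : Continuous F) {δ : ℝ} (hδ : 0 < δ)
    (hfib : ∀ x₀, ∃ β : Fin L → J → Fin q, ∀ x, (∀ c, |F x c - F x₀ c| ≤ δ) →
      ∃ e, ∀ j, lab (x j) = β e j) :
    q ^ Fintype.card J ≤ 16 ^ k * 4 ^ Fintype.card J * L * q ^ (k + 1) := by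
  classical
  set n := Fintype.card J with hn
  obtain ⟨a, ha, har⟩ : ∃ a, 0 < a ∧ n * L ≤ 2 ^ a :=
    ⟨n * L + 1, by omega, (Nat.lt_two_pow_self (n := n * L)).le.trans
      (Nat.pow_le_pow_right (by norm_num) (by omega))⟩
  set r := 2 ^ a with hr
  have hr0 : 0 < r := by positivity
  set N := k * (r - 1) with hN
  have hNk : N ≤ k * r := Nat.mul_le_mul_left _ (Nat.sub_le _ _)
  let G := Fin a → ZMod 2
  let X := G × J
  have hX : Fintype.card X = r * n := by simp [X, G, hr, hn, ZMod.card]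
  let P := SignedPath N (topCount a k)
  let φ : P → X → Fin (N + 1) → J × PVertex a N :=
    fun p x s => (x.2, signAct x.1 (pathVertex p s))
  have hφ : ∀ p x x' s s', φ p x s = φ p x' s' → x = x' ∧ s = s' := by
    intro p x x' s s' h
    obtain ⟨h1, h2⟩ := Prod.ext_iff.1 h
    obtain ⟨h3, h4⟩ := signAct_pathVertex_inj p h2
    exact ⟨Prod.ext h3 h1, h4⟩
  obtain ⟨h, τ, hh, hτ, hτη, hgen⟩ := exists_generic_perturbation φ hφ
    (η := 1 / (3 * ((N : ℝ) + 1))) (by positivity)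
  have hη : 2 * (1 / (3 * ((N : ℝ) + 1))) + τ ≤ 1 / (N + 1) := by
    refine (add_le_add_right hτη _).trans (le_of_eq ?_)
    field_simp
    norm_num
  choose arr harr using fun p : P => exists_optimal_arrangement fun x s => h (φ p x s)
  have hcount := pow_card_le_card_mul (X := X) (K := J × PVertex a N)
    (P := P × Sym (Fin (N + 1)) (Fintype.card X) × Finset X × (Fin L → J → Fin q) × (G → Fin L))
    (N := N) hq (fun t => t.2.2.1) (fun t x => φ t.1 x (arr t.1 t.2.1 x))
    (fun t x x' hx => (hφ _ _ _ _ _ hx).1) (fun t x => t.2.2.2.1 (t.2.2.2.2 x.1) x.2) (by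
      intro c
      let A : (PVertex a N → ℝ) → J → unitInterval := fun l j =>
        ⟨softChoice τ (fun V => (val (c (j, V)) : ℝ)) (fun V => l V + h (j, V)),
          softChoice_mem hτ (fun V => (val (c (j, V))).2) _⟩
      have hA : Continuous A := by
        refine continuous_pi fun j => Continuous.subtype_mk ?_ _
        refine (continuous_softChoice hτ _).comp ?_
        fun_prop
      obtain ⟨p, w, hw0, hw, hnear⟩ := exists_weight_near_coincidence hN ha hk
        (fun l => F (A l)) (hF.comp hA).continuousOn hδ
      obtain ⟨β, hβ⟩ := hfib (A (pushWeight p 0 w))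
      choose e he using fun g => hβ _ (hnear g)
      have hmax : ∀ x, ∃ s₀, ∀ s, w s + h (φ p x s) ≤ w s₀ + h (φ p x s₀) := by
        intro x
        obtain ⟨s₀, -, hs₀⟩ := exists_max_image univ (fun s => w s + h (φ p x s)) univ_nonempty
        exact ⟨s₀, fun s => hs₀ s (mem_univ s)⟩
      choose f hf using hmax
      obtain ⟨t, ht⟩ := harr p w f hf
      refine ⟨(p, t, _, β, e), hgen p w, fun x hx => ?_⟩
      replace hx : ¬ ∃ s s', s ≠ s' ∧ |w s + h (φ p x s) - (w s' + h (φ p x s'))| ≤ τ :=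
        fun h => hx (mem_filter.2 ⟨mem_univ x, h⟩)
      simp only [not_exists, not_and, not_le] at hx
      have htie : ∀ s ≠ f x, τ < |(w (f x) + h (φ p x (f x))) - (w s + h (φ p x s))| :=
        fun s hs => hx _ _ hs.symm
      have h1 : arr p t x = f x := ht x fun s hs => by
        have := htie s hs
        rw [abs_of_nonneg (sub_nonneg.2 (hf x s))] at this
        linarith
      have h2 : A (pushWeight p x.1 w) x.2 = val (c (φ p x (f x))) :=
        Subtype.ext (softChoice_eq hτ _
          (le_sub_of_no_tie p x.1 hw (h := fun V => h (x.2, V)) hη (fun V => hh _) (hf x) htie))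
      have h3 := he x.1 x.2
      rw [h2, hlab] at h3
      simp only [h1]
      exact h3)
  have hS := card_sym_le N (Fintype.card X)
  have hG : Fintype.card G = r := by simp [G, hr, ZMod.card]
  have hcard : Fintype.card (P × Sym (Fin (N + 1)) (Fintype.card X) × Finset X ×
      (Fin L → J → Fin q) × (G → Fin L)) = Fintype.card P *
      (Fintype.card (Sym (Fin (N + 1)) (Fintype.card X)) * (2 ^ (r * n) *
        ((q ^ n) ^ L * L ^ r))) := by
    rw [Fintype.card_prod P, Fintype.card_prod (Sym _ _), Fintype.card_prod (Finset X),
      Fintype.card_prod (Fin L → J → Fin q), Fintype.card_finset, hX]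
    simp only [Fintype.card_fun, Fintype.card_fin, hG, ← hn]
  rw [hcard, hX] at hcount
  rw [hX] at hS
  have hfinal : (q ^ n) ^ r ≤ (16 ^ k * 4 ^ n * L * q ^ (k + 1)) ^ r := by
    calc (q ^ n) ^ r = q ^ (r * n) := by rw [← pow_mul, mul_comm]
      _ ≤ _ := hcount
      _ ≤ ((4 ^ (k * r) * 2 ^ (k * r)) * (2 ^ (k * r + r * n) * (2 ^ (r * n) *
          (q ^ r * L ^ r)))) * q ^ (k * r) := by
        refine Nat.mul_le_mul (Nat.mul_le_mul ?_ (Nat.mul_le_mul ?_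
          (Nat.mul_le_mul le_rfl (Nat.mul_le_mul ?_ le_rfl)))) (Nat.pow_le_pow_right hq hNk)
        · exact (card_signedPath a k).trans
            (Nat.mul_le_mul le_rfl (Nat.pow_le_pow_right (by norm_num) hNk))
        · exact hS.trans (Nat.pow_le_pow_right (by norm_num) (by omega))
        · rw [← pow_mul]
          exact Nat.pow_le_pow_right hq har
      _ = (16 ^ k * 4 ^ n * L * q ^ (k + 1)) ^ r := by
        have e16 : (16 : ℕ) = 4 * 2 * 2 := by norm_num
        have e4 : (4 : ℕ) ^ n = 2 ^ n * 2 ^ n := by rw [← mul_pow]; rfl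
        rw [e16, e4]
        simp only [mul_pow, pow_add, pow_mul, pow_one, mul_comm r n]
        ring
  exact (Nat.pow_le_pow_iff_left hr0.ne').1 hfinal

end Waist

section Pseudometric

variable {X : Type*}

/-- A distance function `ρ` is a pseudometric, continuous for the topology of `X`. -/
structure IsContPseudometric [TopologicalSpace X] (ρ : X → X → ℝ) : Prop where
  self : ∀ x, ρ x x = 0
  symm : ∀ x y, ρ x y = ρ y x
  triangle : ∀ x y z, ρ x z ≤ ρ x y + ρ y z
  near : ∀ x, ∀ δ > 0, ∀ᶠ y in 𝓝 x, ρ x y < δ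

variable {ρ : X → X → ℝ} {ε : ℝ}

lemma lt_of_setEDiam_lt {U : Set X} (h : setEDiam ρ U < ENNReal.ofReal ε)
    {x y : X} (hx : x ∈ U) (hy : y ∈ U) : ρ x y < ε := by
  have h1 : ENNReal.ofReal (ρ x y) ≤ setEDiam ρ U :=
    le_iSup₂_of_le x hx (le_iSup₂_of_le y hy le_rfl)
  exact (ENNReal.ofReal_lt_ofReal_iff'.1 (h1.trans_lt h)).1

lemma setEDiam_lt {U : Set X} {r : ℝ} (hr : r < ε) (hε : 0 < ε)
    (h : ∀ x ∈ U, ∀ y ∈ U, ρ x y ≤ r) : setEDiam ρ U < ENNReal.ofReal ε := by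
  refine lt_of_le_of_lt ?_ ((ENNReal.ofReal_lt_ofReal_iff hε).2 hr)
  exact iSup₂_le fun x hx => iSup₂_le fun y hy => ENNReal.ofReal_le_ofReal (h x hx y hy)

variable [TopologicalSpace X]

namespace IsContPseudometric

lemma nonneg (h : IsContPseudometric ρ) (x y : X) : 0 ≤ ρ x y := by
  have h1 := h.triangle x y x
  rw [h.self, h.symm y x] at h1
  linarith

lemma isOpen (h : IsContPseudometric ρ) {U : Set X} (hU : ROpen ρ U) : IsOpen U := by
  refine isOpen_iff_mem_nhds.2 fun x hx => ?_
  obtain ⟨δ, hδ, h1⟩ := hU x hx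
  exact mem_of_superset (h.near x δ hδ) h1

lemma rOpen_ball (h : IsContPseudometric ρ) (x : X) (r : ℝ) : ROpen ρ {y | ρ x y < r} :=
  fun y hy => ⟨r - ρ x y, sub_pos.2 hy, fun z hz => by
    have := h.triangle x y z
    simp only [Set.mem_ofPred_eq]
    linarith⟩

lemma setEDiam_ball_lt (h : IsContPseudometric ρ) (hε : 0 < ε) (x : X) :
    setEDiam ρ {y | ρ x y < ε / 3} < ENNReal.ofReal ε := by
  refine setEDiam_lt (r := 2 * ε / 3) (by linarith) hε fun y hy z hz => ?_
  have := h.triangle y x z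
  rw [h.symm y x] at this
  simp only [Set.mem_ofPred_eq] at hy hz
  linarith

lemma exists_finset_ball [CompactSpace X] (h : IsContPseudometric ρ) (hε : 0 < ε) :
    ∃ t : Finset X, ∀ x, ∃ c ∈ t, ρ c x < ε := by
  obtain ⟨t, ht⟩ := isCompact_univ.elim_finite_subcover (fun c => {x | ρ c x < ε})
    (fun c => h.isOpen (h.rOpen_ball c ε)) fun x _ => Set.mem_iUnion.2 ⟨x, by simpa [h.self] using hε⟩
  exact ⟨t, fun x => by simpa using ht (Set.mem_univ x)⟩

lemma covNum_set_nonempty [CompactSpace X] (h : IsContPseudometric ρ) (hε : 0 < ε) (E : Set X) :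
    {n : ℕ | ∃ U : Fin n → Set X, (∀ i, ROpen ρ (U i)) ∧
      (∀ i, setEDiam ρ (U i) < ENNReal.ofReal ε) ∧ E ⊆ ⋃ i, U i}.Nonempty := by
  obtain ⟨t, ht⟩ := h.exists_finset_ball (ε := ε / 3) (by linarith)
  refine ⟨t.card, fun i => {y | ρ (t.equivFin.symm i) y < ε / 3}, fun i => h.rOpen_ball _ _,
    fun i => h.setEDiam_ball_lt hε _, fun x _ => ?_⟩
  obtain ⟨c, hc, h1⟩ := ht x
  exact Set.mem_iUnion.2 ⟨t.equivFin ⟨c, hc⟩, by simpa using h1⟩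

lemma covNum_mono [CompactSpace X] (h : IsContPseudometric ρ) (hε : 0 < ε) {E E' : Set X}
    (hE : E ⊆ E') : covNum ρ ε E ≤ covNum ρ ε E' := by
  obtain ⟨U, h1, h2, h3⟩ := Nat.sInf_mem (h.covNum_set_nonempty hε E')
  exact Nat.sInf_le ⟨U, h1, h2, hE.trans h3⟩

lemma exists_cover [CompactSpace X] (h : IsContPseudometric ρ) (hε : 0 < ε) {E : Set X} {K : ℕ}
    (hK : covNum ρ ε E ≤ K) : ∃ U : Fin K → Set X, (∀ i, IsOpen (U i)) ∧
      (∀ i, ∀ x ∈ U i, ∀ y ∈ U i, ρ x y < ε) ∧ E ⊆ ⋃ i, U i := by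
  obtain ⟨U, h1, h2, h3⟩ := Nat.sInf_mem (h.covNum_set_nonempty hε E)
  refine ⟨fun i => if hi : (i : ℕ) < covNum ρ ε E then U ⟨i, hi⟩ else ∅, fun i => ?_,
    fun i x hx y hy => ?_, fun x hx => ?_⟩
  · dsimp only
    split_ifs
    · exact h.isOpen (h1 _)
    · exact isOpen_empty
  · dsimp only at hx hy
    split_ifs at hx hy
    · exact lt_of_setEDiam_lt (h2 _) hx hy
    · exact hx.elim
  · obtain ⟨i, hi⟩ := Set.mem_iUnion.1 (h3 hx)
    refine Set.mem_iUnion.2 ⟨⟨i, i.2.trans_le hK⟩, ?_⟩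
    rw [dif_pos (show ((⟨i, i.2.trans_le hK⟩ : Fin K) : ℕ) < covNum ρ ε E from i.2)]
    exact hi

/-- The largest covering number of a fiber bounds all of them and is detected by `supLogCov`. -/
lemma exists_covNum_fiber_le [CompactSpace X] {Y : Type*} [Nonempty Y]
    (h : IsContPseudometric ρ) (hε : 0 < ε) (π : X → Y) :
    ∃ K : ℕ, (∀ y, covNum ρ ε (π ⁻¹' {y}) ≤ K) ∧ Real.log K ≤ supLogCov π ρ ε := by
  have hle : ∀ y, covNum ρ ε (π ⁻¹' {y}) ≤ covNum ρ ε (Set.univ : Set X) :=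
    fun y => h.covNum_mono hε (Set.subset_univ _)
  have hb : BddAbove (Set.range fun y => covNum ρ ε (π ⁻¹' {y})) :=
    ⟨_, Set.forall_mem_range.2 hle⟩
  obtain ⟨y₀, hy₀⟩ := Nat.sSup_mem (Set.range_nonempty _) hb
  refine ⟨covNum ρ ε (π ⁻¹' {y₀}), fun y => ?_, ?_⟩
  · exact (le_csSup hb (Set.mem_range_self y)).trans hy₀.ge
  · refine le_ciSup (f := fun y => Real.log (covNum ρ ε (π ⁻¹' {y}) : ℝ)) ⟨Real.log
      (covNum ρ ε (Set.univ : Set X)), Set.forall_mem_range.2 fun y => ?_⟩ y₀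
    rcases Nat.eq_zero_or_pos (covNum ρ ε (π ⁻¹' {y})) with h0 | h0
    · simp only [h0, Nat.cast_zero, Real.log_zero]
      exact Real.log_natCast_nonneg _
    · exact Real.log_le_log (by exact_mod_cast h0) (by exact_mod_cast hle y)

end IsContPseudometric

end Pseudometric

section DynDist

variable {X : Type*} {T : X → X} {d : X → X → ℝ} {N : ℕ}

lemma le_dynDist {n : ℕ} (hn : n < N) (x y : X) :
    d (T^[n] x) (T^[n] y) ≤ dynDist T d N x y := by
  refine le_csSup (Set.Finite.bddAbove ?_) ⟨n, hn, rfl⟩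
  refine ((Set.finite_lt_nat N).image fun n => d (T^[n] x) (T^[n] y)).subset ?_
  rintro r ⟨n, hn, rfl⟩
  exact ⟨n, hn, rfl⟩

lemma dynDist_le {r : ℝ} (hr : 0 ≤ r) {x y : X} (h : ∀ n < N, d (T^[n] x) (T^[n] y) ≤ r) :
    dynDist T d N x y ≤ r :=
  Real.sSup_le (by rintro _ ⟨n, hn, rfl⟩; exact h n hn) hr

lemma isContPseudometric_dynDist [TopologicalSpace X] (h : IsContPseudometric d) (hT : Continuous T) (N : ℕ) :
    IsContPseudometric (dynDist T d N) := by
  have h0 : ∀ x y, 0 ≤ dynDist T d N x y := fun x y =>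
    Real.sSup_nonneg (by rintro _ ⟨n, hn, rfl⟩; exact h.nonneg _ _)
  refine ⟨fun x => (dynDist_le le_rfl fun n _ => (h.self _).le).antisymm (h0 x x), fun x y => ?_,
    fun x y z => ?_, fun x δ hδ => ?_⟩
  · simp only [dynDist, h.symm (T^[_] x)]
  · exact dynDist_le (add_nonneg (h0 _ _) (h0 _ _)) fun n hn =>
      (h.triangle _ (T^[n] y) _).trans (add_le_add (le_dynDist hn _ _) (le_dynDist hn _ _))
  · have h1 : ∀ n ∈ Finset.range N, ∀ᶠ y in 𝓝 x, d (T^[n] x) (T^[n] y) < δ / 2 := fun n _ =>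
      (hT.iterate n).continuousAt.eventually (h.near (T^[n] x) (δ / 2) (by linarith))
    filter_upwards [(Finset.eventually_all _).2 h1] with y hy
    refine (dynDist_le (r := δ / 2) (by linarith) fun n hn => ?_).trans_lt (by linarith)
    exact (hy n (Finset.mem_range.2 hn)).le

end DynDist

lemma isContPseudometric_dist {Y : Type*} [MetricSpace Y] :
    IsContPseudometric (dist : Y → Y → ℝ) where
  self := dist_self
  symm := dist_comm
  triangle := dist_triangle
  near x δ hδ := by
    filter_upwards [Metric.ball_mem_nhds x hδ] with y hy
    rwa [Metric.mem_ball, dist_comm] at hy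

section FullShift

variable {a : ℕ}

lemma cubeDist_nonneg (x y : Cube a) : 0 ≤ cubeDist x y := norm_nonneg _

lemma abs_sub_le_cubeDist (x y : Cube a) (i : Fin a) : |(x i : ℝ) - y i| ≤ cubeDist x y :=
  norm_le_pi_norm ((fun i => (x i : ℝ)) - fun i => (y i : ℝ)) i

lemma cubeDist_le_one (x y : Cube a) : cubeDist x y ≤ 1 := by
  refine (pi_norm_le_iff_of_nonneg zero_le_one).2 fun i => ?_
  rw [Pi.sub_apply, Real.norm_eq_abs, abs_le]
  have h1 := (x i).2
  have h2 := (y i).2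
  constructor <;> linarith [h1.1, h1.2, h2.1, h2.2]

lemma summable_two_zpow_neg_abs : Summable fun n : ℤ => (2 : ℝ) ^ (-|n|) := by
  rw [summable_int_iff_summable_nat_and_neg]
  have : Summable fun n : ℕ => (2 : ℝ) ^ (-|(n : ℤ)|) := by
    refine (summable_geometric_two).congr fun n => ?_
    simp [zpow_neg]
  exact ⟨this, by simpa using this⟩

lemma shiftDist_term_le (x y : FullShift a) (n : ℤ) :
    (2 : ℝ) ^ (-|n|) * cubeDist (x n) (y n) ≤ (2 : ℝ) ^ (-|n|) :=
  mul_le_of_le_one_right (by positivity) (cubeDist_le_one _ _)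

lemma summable_shiftDist (x y : FullShift a) :
    Summable fun n : ℤ => (2 : ℝ) ^ (-|n|) * cubeDist (x n) (y n) :=
  Summable.of_nonneg_of_le (fun n => mul_nonneg (by positivity) (cubeDist_nonneg _ _))
    (shiftDist_term_le x y) summable_two_zpow_neg_abs

lemma cubeDist_le_shiftDist (x y : FullShift a) : cubeDist (x 0) (y 0) ≤ shiftDist x y := by
  have := (summable_shiftDist x y).le_tsum 0 fun n _ =>
    mul_nonneg (by positivity) (cubeDist_nonneg _ _)
  simpa [shiftDist] using this

lemma continuous_shiftDist (x : FullShift a) : Continuous fun y => shiftDist x y := by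
  refine continuous_tsum (fun n => ?_) summable_two_zpow_neg_abs fun n y => ?_
  · unfold cubeDist
    fun_prop
  · rw [Real.norm_of_nonneg (mul_nonneg (by positivity) (cubeDist_nonneg _ _))]
    exact shiftDist_term_le x y n

lemma isContPseudometric_shiftDist : IsContPseudometric (shiftDist (a := a)) := by
  have hself : ∀ x : FullShift a, shiftDist x x = 0 := fun x => by simp [shiftDist, cubeDist]
  refine ⟨hself, fun x y => ?_, fun x y z => ?_, fun x δ hδ => ?_⟩
  · simp only [shiftDist, cubeDist, norm_sub_rev]
  · rw [shiftDist, shiftDist, shiftDist,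
      ← (summable_shiftDist x y).tsum_add (summable_shiftDist y z)]
    refine (summable_shiftDist x z).tsum_le_tsum (fun n => ?_)
      ((summable_shiftDist x y).add (summable_shiftDist y z))
    rw [← mul_add]
    exact mul_le_mul_of_nonneg_left (norm_sub_le_norm_sub_add_norm_sub _ _ _) (by positivity)
  · exact (continuous_shiftDist x).continuousAt.eventually_lt_const (by simpa [hself] using hδ)

lemma continuous_shift {α : Type*} [TopologicalSpace α] : Continuous (shift (α := α)) :=
  continuous_pi fun n => continuous_apply (n + 1)

lemma shift_iterate {α : Type*} (n : ℕ) (x : ℤ → α) (i : ℤ) : shift^[n] x i = x (i + n) := by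
  induction n generalizing x with
  | zero => simp
  | succ n ih =>
    rw [Function.iterate_succ_apply, ih, shift]
    push_cast
    congr 1
    ring

lemma abs_sub_le_dynDist {M n : ℕ} (hn : n < M) (x y : FullShift a) (j : Fin a) :
    |(x n j : ℝ) - y n j| ≤ dynDist shift shiftDist M x y := by
  refine le_trans ?_ (le_dynDist hn x y)
  refine le_trans ?_ (cubeDist_le_shiftDist _ _)
  simpa [shift_iterate] using abs_sub_le_cubeDist (shift^[n] x 0) (shift^[n] y 0) j

end FullShift

section FiberNeighborhood

/-- If every fiber of a continuous map on a compact space lies in a member of a family of open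
sets, then so do uniform neighborhoods of the fibers. -/
lemma exists_pos_forall_preimage_ball_subset {X Z : Type*} [TopologicalSpace X] [CompactSpace X]
    [MetricSpace Z] {f : X → Z} (hf : Continuous f) (𝒰 : Set (Set X)) (h𝒰 : ∀ U ∈ 𝒰, IsOpen U)
    (h : ∀ x₀, ∃ U ∈ 𝒰, ∀ x, f x = f x₀ → x ∈ U) :
    ∃ δ > 0, ∀ x₀, ∃ U ∈ 𝒰, ∀ x, dist (f x) (f x₀) ≤ δ → x ∈ U := by
  choose U hU hfU using h
  have hop : ∀ x₀, IsOpen (f '' (U x₀)ᶜ)ᶜ := fun x₀ =>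
    ((h𝒰 _ (hU x₀)).isClosed_compl.isCompact.image hf).isClosed.isOpen_compl
  obtain ⟨δ, hδ, h1⟩ := lebesgue_number_lemma_of_metric (isCompact_range hf) hop (by
    rintro _ ⟨x₀, rfl⟩
    refine Set.mem_iUnion.2 ⟨x₀, ?_⟩
    rintro ⟨x, hx, hxx⟩
    exact hx (hfU x₀ x hxx))
  refine ⟨δ / 2, by linarith, fun x₀ => ?_⟩
  obtain ⟨i, hi⟩ := h1 (f x₀) (Set.mem_range_self x₀)
  refine ⟨U i, hU i, fun x hx => ?_⟩
  by_contra hxU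
  exact hi (Metric.mem_ball.2 (by linarith : dist (f x) (f x₀) < δ)) ⟨x, hxU, rfl⟩

end FiberNeighborhood

section Labels

/-- The midpoint of a cell of the unit interval. -/
noncomputable def cellValue {q : ℕ} (c : Fin q) : unitInterval :=
  ⟨((c : ℝ) + 1 / 2) / q, by
    have h : (c : ℝ) + 1 ≤ q := by exact_mod_cast c.2
    have h0 : (0 : ℝ) ≤ c := Nat.cast_nonneg _
    refine ⟨by positivity, div_le_one_of_le₀ (by linarith) (by linarith)⟩⟩

/-- The cell of a point of the unit interval. -/
noncomputable def cellLabel {q : ℕ} (hq : 0 < q) (x : unitInterval) : Fin q :=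
  ⟨min ⌊(x : ℝ) * q⌋₊ (q - 1), by omega⟩

lemma cellLabel_cellValue {q : ℕ} (hq : 0 < q) (c : Fin q) : cellLabel hq (cellValue c) = c := by
  have hq' : (q : ℝ) ≠ 0 := by exact_mod_cast hq.ne'
  have h : ⌊((cellValue c : unitInterval) : ℝ) * q⌋₊ = c := by
    rw [cellValue, div_mul_cancel₀ _ hq', Nat.floor_eq_iff (by positivity)]
    constructor <;> linarith
  refine Fin.ext ?_
  simp only [cellLabel, h]
  have := c.2
  omega

lemma cellLabel_le {q : ℕ} (hq : 0 < q) {ε : ℝ} (hqε : (q : ℝ) * ε ≤ 1) {x y : unitInterval}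
    (h : |(x : ℝ) - y| < ε) : (cellLabel hq x : ℕ) ≤ cellLabel hq y + 1 := by
  have hq' : (0 : ℝ) < q := by exact_mod_cast hq
  have h1 : (x : ℝ) * q ≤ y * q + 1 := by
    have := (abs_lt.1 h).2
    nlinarith
  have h2 : ⌊(x : ℝ) * q⌋₊ ≤ ⌊(y : ℝ) * q⌋₊ + 1 := by
    have hy : (0 : ℝ) ≤ y * q := mul_nonneg y.2.1 hq'.le
    rw [← Nat.floor_add_one hy]
    exact Nat.floor_le_floor h1
  simp only [cellLabel]
  omega

/-- A set of small coordinate diameter carries few label patterns. -/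
lemma exists_label_patterns {J : Type*} {q : ℕ} (hq : 0 < q) {ε : ℝ} (hqε : (q : ℝ) * ε ≤ 1)
    (W : Set (J → unitInterval)) (hW : ∀ x ∈ W, ∀ y ∈ W, ∀ j, |(x j : ℝ) - y j| < ε) :
    ∃ β : (J → Bool) → J → Fin q, ∀ x ∈ W, ∃ b, ∀ j, cellLabel hq (x j) = β b j := by
  classical
  have key : ∀ j, ∃ γ : Bool → Fin q, ∀ x ∈ W, ∃ b, cellLabel hq (x j) = γ b := by
    intro j
    rcases W.eq_empty_or_nonempty with rfl | hne
    · exact ⟨fun _ => ⟨0, hq⟩, fun x hx => hx.elim⟩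
    obtain ⟨x₀, hx₀, hmin⟩ := WellFounded.has_min
      (InvImage.wf (fun x : J → unitInterval => (cellLabel hq (x j) : ℕ)) wellFounded_lt) W hne
    refine ⟨fun b => if b then ⟨min (cellLabel hq (x₀ j) + 1) (q - 1), by omega⟩
      else cellLabel hq (x₀ j), fun x hx => ?_⟩
    have h1 : (cellLabel hq (x₀ j) : ℕ) ≤ cellLabel hq (x j) := not_lt.1 (hmin x hx)
    have h2 := cellLabel_le hq hqε (hW x hx x₀ hx₀ j)
    rcases h1.eq_or_lt with h3 | h3
    · exact ⟨false, by simpa using Fin.ext h3.symm⟩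
    · refine ⟨true, Fin.ext ?_⟩
      have := (cellLabel hq (x j)).2
      simp only [if_true]
      omega
  choose γ hγ using key
  refine ⟨fun b j => γ j (b j), fun x hx => ?_⟩
  choose b hb using fun j => hγ j x hx
  exact ⟨b, hb⟩

end Labels

section Embedding

variable {a : ℕ}

/-- The inclusion of a finite window of coordinates into the full shift. -/
def windowEmbed (R : ℕ) (x : Fin R × Fin a → unitInterval) : FullShift a := fun n j =>
  if h : 0 ≤ n ∧ n < R then x (⟨n.toNat, by omega⟩, j) else 0

lemma continuous_windowEmbed (R : ℕ) : Continuous (windowEmbed (a := a) R) := by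
  refine continuous_pi fun n => continuous_pi fun j => ?_
  unfold windowEmbed
  split_ifs <;> fun_prop

lemma windowEmbed_apply (R : ℕ) (x : Fin R × Fin a → unitInterval) (i : Fin R) (j : Fin a) :
    windowEmbed R x ((i : ℕ) : ℤ) j = x (i, j) := by
  unfold windowEmbed
  rw [dif_pos ⟨by omega, by exact_mod_cast i.2⟩]
  rfl

/-- If a map from the base to `ℝᵏ` almost separates orbit segments, the covering numbers of the
fibers cannot be small. -/
theorem pow_card_le_of_separating {Y : Type*} [MetricSpace Y] {S : Y → Y} {π : FullShift a → Y}
    (hπ : Continuous π) (hequiv : ∀ x, π (shift x) = S (π x)) {M p K k q : ℕ} {ε δ : ℝ}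
    (hM : 0 < M) (hk : 0 < k) (hq : 0 < q) (hqε : (q : ℝ) * ε ≤ 1)
    (hcov : ∀ x₀, ∃ U : Fin K → Set (FullShift a), (∀ i, IsOpen (U i)) ∧
      (∀ i, ∀ x ∈ U i, ∀ y ∈ U i, dynDist shift shiftDist M x y < ε) ∧
      ∀ x, dist (π x) (π x₀) ≤ δ → x ∈ ⋃ i, U i)
    {g : Y → Fin k → ℝ} (hg : Continuous g)
    (hsep : ∀ y y', g y = g y' → ∀ n < p * M, dist (S^[n] y) (S^[n] y') ≤ δ) :
    q ^ (p * M * a) ≤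
      16 ^ k * 4 ^ (p * M * a) * (K ^ p * 2 ^ (p * M * a)) * q ^ (k + 1) := by
  classical
  set R := p * M with hR
  let J := Fin R × Fin a
  have hJ : Fintype.card J = R * a := by simp [J]
  have hiter : ∀ n x, π (shift^[n] x) = S^[n] (π x) := fun n x =>
    (Function.Semiconj.iterate_right (f := π) (ga := shift) (gb := S) hequiv n) x
  choose U hUo hUε hUc using hcov
  let F : (J → unitInterval) → Fin k → ℝ := fun x => g (π (windowEmbed R x))
  have hF : Continuous F := hg.comp (hπ.comp (continuous_windowEmbed R))
  let 𝒲 : Set ((Fin p → Fin K) → Set (J → unitInterval)) :=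
    {W | ∀ c, IsOpen (W c) ∧ ∀ x ∈ W c, ∀ y ∈ W c, ∀ j, |(x j : ℝ) - y j| < ε}
  obtain ⟨δ', hδ', hnbhd⟩ := exists_pos_forall_preimage_ball_subset hF
    ((fun W : (Fin p → Fin K) → Set (J → unitInterval) => ⋃ c, W c) '' 𝒲)
    (by rintro _ ⟨W, hW, rfl⟩; exact isOpen_iUnion fun c => (hW c).1) (by
      intro x₀
      let V : Fin p → Fin K → Set (FullShift a) := fun i => U (shift^[i * M] (windowEmbed R x₀))
      refine ⟨_, ⟨fun c => ⋂ i : Fin p, (fun x => shift^[i * M] (windowEmbed R x)) ⁻¹' V i (c i),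
        fun c => ⟨isOpen_iInter_of_finite fun i => (hUo _ _).preimage
          ((continuous_shift.iterate _).comp (continuous_windowEmbed R)), ?_⟩, rfl⟩, ?_⟩
      · rintro x hx y hy ⟨j, l⟩
        have hjp : (j : ℕ) / M < p := Nat.div_lt_of_lt_mul (by rw [mul_comm]; exact j.2)
        have h1 := hUε _ _ _ (Set.mem_iInter.1 hx ⟨j / M, hjp⟩) _ (Set.mem_iInter.1 hy ⟨j / M, hjp⟩)
        refine lt_of_le_of_lt ?_ h1
        have h2 := abs_sub_le_dynDist (Nat.mod_lt (j : ℕ) hM)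
          (shift^[(j : ℕ) / M * M] (windowEmbed R x)) (shift^[(j : ℕ) / M * M] (windowEmbed R y)) l
        have h3 : (((j : ℕ) % M : ℕ) : ℤ) + (((j : ℕ) / M * M : ℕ) : ℤ) = ((j : ℕ) : ℤ) := by
          exact_mod_cast Nat.mod_add_div' _ _
        rw [shift_iterate, shift_iterate, h3, windowEmbed_apply, windowEmbed_apply] at h2
        exact h2
      · intro x hx
        have h1 : ∀ i : Fin p, ∃ c, shift^[i * M] (windowEmbed R x) ∈ V i c := by
          intro i
          refine Set.mem_iUnion.1 (hUc _ _ ?_)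
          rw [hiter, hiter]
          exact hsep _ _ hx _ (Nat.mul_lt_mul_of_pos_right i.2 hM)
        choose c hc using h1
        exact Set.mem_iUnion.2 ⟨c, Set.mem_iInter.2 hc⟩)
  have hmain := waist_inequality (J := J) (L := Fintype.card ((Fin p → Fin K) × (J → Bool))) hk hq
    cellValue (cellLabel hq) (cellLabel_cellValue hq) hF hδ' (by
      intro x₀
      obtain ⟨_, ⟨W, hW, rfl⟩, hx₀⟩ := hnbhd x₀
      choose β hβ using fun c => exists_label_patterns hq hqε (W c) (hW c).2
      let e := Fintype.equivFin ((Fin p → Fin K) × (J → Bool))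
      refine ⟨fun i => β (e.symm i).1 (e.symm i).2, fun x hx => ?_⟩
      obtain ⟨c, hc⟩ := Set.mem_iUnion.1 (hx₀ x ((dist_pi_le_iff hδ'.le).2 fun i => hx i))
      obtain ⟨b, hb⟩ := hβ c x hc
      exact ⟨e (c, b), by simpa using hb⟩)
  have hL : Fintype.card ((Fin p → Fin K) × (J → Bool)) = K ^ p * 2 ^ (R * a) := by
    simp [J]
  rwa [hL, hJ] at hmain

end Embedding

section Projection

/-- A generic linear map to `ℝᵈ` is injective on finitely many subspaces of dimension at most `d`. -/
lemma exists_linearMap_injective_on {V ι : Type*} [AddCommGroup V] [Module ℝ V]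
    [FiniteDimensional ℝ V] [Finite ι] (d : ℕ) (p : ι → Submodule ℝ V)
    (hp : ∀ i, Module.finrank ℝ (p i) ≤ d) :
    ∃ L : V →ₗ[ℝ] (Fin d → ℝ), ∀ i, ∀ x ∈ p i, L x = 0 → x = 0 := by
  classical
  induction d generalizing p with
  | zero =>
    refine ⟨0, fun i x hx _ => ?_⟩
    have h := Submodule.finrank_eq_zero.1 (Nat.le_zero.1 (hp i))
    rw [h] at hx
    exact (Submodule.mem_bot ℝ).1 hx
  | succ d ih =>
    have hv : ∀ i : {i // p i ≠ ⊥}, ∃ v ∈ p i.1, v ≠ 0 := fun i => (Submodule.ne_bot_iff _).1 i.2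
    choose v hv hv0 using hv
    obtain ⟨f, hf⟩ := Module.exists_dual_forall_apply_ne_zero (K := ℝ) v hv0
    obtain ⟨L, hL⟩ := ih (fun i => p i ⊓ LinearMap.ker f) (by
      intro i
      by_cases hi : p i = ⊥
      · show Module.finrank ℝ ↥(p i ⊓ LinearMap.ker f) ≤ d
        rw [hi, bot_inf_eq, finrank_bot]
        omega
      · have hlt : p i ⊓ LinearMap.ker f < p i := by
          refine lt_of_le_of_ne inf_le_left fun h => hf ⟨i, hi⟩ ?_
          have := hv ⟨i, hi⟩
          rw [← h] at this
          exact this.2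
        have := (Submodule.finrank_lt_finrank_of_lt hlt).trans_le (hp i)
        omega)
    refine ⟨LinearMap.pi (Fin.cons f fun j => LinearMap.proj j ∘ₗ L), fun i x hx h => ?_⟩
    have h0 : f x = 0 := by simpa using congrFun h 0
    refine hL i x ⟨hx, h0⟩ (funext fun j => ?_)
    simpa using congrFun h j.succ

lemma exists_linearMap_injOn_space {m w : ℕ} (K : Geometry.SimplicialComplex ℝ (Fin m → ℝ))
    (hfin : K.faces.Finite) (hcard : ∀ s ∈ K.faces, s.card ≤ w + 1) :
    ∃ L : (Fin m → ℝ) →ₗ[ℝ] (Fin (2 * w + 1) → ℝ), Set.InjOn L K.space := by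
  classical
  have : Finite K.faces := hfin
  obtain ⟨L, hL⟩ := exists_linearMap_injective_on (2 * w + 1)
    (fun st : K.faces × K.faces => vectorSpan ℝ ((st.1.1 ∪ st.2.1 : Finset (Fin m → ℝ)) : Set (Fin m → ℝ))) (by
      rintro ⟨⟨s, hs⟩, ⟨t, ht⟩⟩
      have h1 := hcard s hs
      have h2 := hcard t ht
      have h3 := Finset.card_union_le s t
      have h4 : 0 < (s ∪ t).card := Finset.card_pos.2 ((K.nonempty_of_mem_faces hs).mono Finset.subset_union_left)
      have h5 := finrank_vectorSpan_image_finset_le ℝ (id : (Fin m → ℝ) → _) (s ∪ t)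
        (n := (s ∪ t).card - 1) (by omega)
      rw [Finset.image_id] at h5
      exact h5.trans (by omega))
  refine ⟨L, fun x hx y hy hxy => ?_⟩
  obtain ⟨s, hs, hxs⟩ := Geometry.SimplicialComplex.mem_space_iff.1 hx
  obtain ⟨t, ht, hyt⟩ := Geometry.SimplicialComplex.mem_space_iff.1 hy
  refine sub_eq_zero.1 (hL (⟨s, hs⟩, ⟨t, ht⟩) (x - y) ?_ (by rw [map_sub, hxy, sub_self]))
  rw [← direction_affineSpan]
  refine AffineSubspace.vsub_mem_direction ?_ ?_
  · exact affineSpan_mono ℝ (by simp) (convexHull_subset_affineSpan _ hxs)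
  · exact affineSpan_mono ℝ (by simp) (convexHull_subset_affineSpan _ hyt)

end Projection

section Widim

variable {Y : Type*} [TopologicalSpace Y] {ρ : Y → Y → ℝ} {δ : ℝ}

lemma exists_fullSimplex (n : ℕ) :
    ∃ K : Geometry.SimplicialComplex ℝ (Fin (n + 1) → ℝ), K.faces.Finite ∧
      (∀ s ∈ K.faces, s.card ≤ n + 1) ∧ stdSimplex ℝ (Fin (n + 1)) ⊆ K.space := by
  classical
  let b : Fin (n + 1) → (Fin (n + 1) → ℝ) := fun i => Pi.single i 1
  let A : Finset (Fin (n + 1) → ℝ) := Finset.univ.image b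
  have hb : AffineIndependent ℝ ((↑) : A → (Fin (n + 1) → ℝ)) := by
    have h1 : LinearIndependent ℝ b := by
      have := (Pi.basisFun ℝ (Fin (n + 1))).linearIndependent
      convert this using 1
      ext i : 1
      simp [b]
    refine h1.affineIndependent.range.mono (s := (A : Set (Fin (n + 1) → ℝ))) ?_
    simp [A]
  have hsub : ∀ {s}, s ⊆ A → AffineIndependent ℝ ((↑) : s → (Fin (n + 1) → ℝ)) :=
    fun hs => hb.mono (by exact_mod_cast hs)
  let K : Geometry.SimplicialComplex ℝ (Fin (n + 1) → ℝ) :=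
    Geometry.SimplicialComplex.ofErase {s | s ⊆ A} (fun s hs => hsub hs)
      (fun s t hts hs => hts.trans hs) (fun s hs t ht => by
        refine subset_of_eq ?_
        rw [AffineIndependent.convexHull_inter (R := ℝ) (s := s ∪ t)]
        · exact hsub (Finset.union_subset hs ht)
        · exact Finset.subset_union_left
        · exact Finset.subset_union_right)
  have hA : A ∈ K.faces := ⟨Finset.Subset.refl A, by simp [A, Finset.univ_nonempty.ne_empty]⟩
  refine ⟨K, ?_, fun s hs => ?_, ?_⟩
  · exact (A.powerset.finite_toSet).subset fun s hs => by simpa using hs.1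
  · refine (Finset.card_le_card hs.1).trans (Finset.card_image_le.trans (by simp))
  · rw [← convexHull_rangle_single_eq_stdSimplex]
    refine subset_trans (convexHull_mono ?_) (K.convexHull_subset_space hA)
    simp [A, b]

lemma IsContPseudometric.continuous (h : IsContPseudometric ρ) (x : Y) : Continuous (ρ x) := by
  refine continuous_iff_continuousAt.2 fun y => Metric.tendsto_nhds.2 fun δ hδ => ?_
  filter_upwards [h.near y δ hδ] with z hz
  rw [Real.dist_eq, abs_lt]
  have h1 := h.triangle x y z
  have h2 := h.triangle x z y
  rw [h.symm z y] at h2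
  constructor <;> linarith

lemma IsContPseudometric.widim_set_nonempty [CompactSpace Y] [Nonempty Y]
    (h : IsContPseudometric ρ) (hδ : 0 < δ) :
    {k : ℕ | ∃ (m : ℕ) (K : Geometry.SimplicialComplex ℝ (Fin m → ℝ)),
      K.faces.Finite ∧ (∀ s ∈ K.faces, s.card ≤ k + 1) ∧
      ∃ f : Y → K.space, Continuous f ∧
        ∀ p : K.space, setEDiam ρ (f ⁻¹' {p}) < ENNReal.ofReal δ}.Nonempty := by
  obtain ⟨t, ht⟩ := h.exists_finset_ball (ε := δ / 3) (by linarith)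
  obtain ⟨n, hn⟩ : ∃ n, t.card = n + 1 := by
    obtain ⟨c, hc, -⟩ := ht (Classical.arbitrary Y)
    exact ⟨t.card - 1, by have := Finset.card_pos.2 ⟨c, hc⟩; omega⟩
  let c : Fin (n + 1) → Y := fun i => ((t.equivFinOfCardEq hn).symm i : Y)
  have hc : ∀ x, ∃ i, ρ (c i) x < δ / 3 := by
    intro x
    obtain ⟨y, hy, hyx⟩ := ht x
    exact ⟨t.equivFinOfCardEq hn ⟨y, hy⟩, by simpa [c] using hyx⟩
  let φ : Y → Fin (n + 1) → ℝ := fun x i => max 0 (δ / 3 - ρ (c i) x)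
  have hφ : ∀ x i, 0 ≤ φ x i := fun x i => le_max_left _ _
  have hφpos : ∀ x i, 0 < φ x i → ρ (c i) x < δ / 3 := by
    intro x i hi
    rcases lt_max_iff.1 hi with h1 | h1 <;> linarith
  have hsum : ∀ x, 0 < ∑ i, φ x i := by
    intro x
    obtain ⟨i, hi⟩ := hc x
    exact Finset.sum_pos' (fun i _ => hφ x i) ⟨i, Finset.mem_univ i, lt_max_of_lt_right (by linarith)⟩
  have hφc : ∀ i, Continuous fun x => φ x i := fun i =>
    continuous_const.max (continuous_const.sub (h.continuous (c i)))
  obtain ⟨K, hK1, hK2, hK3⟩ := exists_fullSimplex n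
  refine ⟨n, n + 1, K, hK1, hK2, fun x => ⟨fun i => φ x i / ∑ j, φ x j, hK3 ⟨fun i =>
    div_nonneg (hφ x i) (hsum x).le, by rw [← Finset.sum_div, div_self (hsum x).ne']⟩⟩, ?_, ?_⟩
  · refine Continuous.subtype_mk (continuous_pi fun i => ?_) _
    exact (hφc i).div (continuous_finsetSum _ fun j _ => hφc j) fun x => (hsum x).ne'
  · intro p
    refine setEDiam_lt (r := 2 * δ / 3) (by linarith) hδ fun x hx y hy => ?_
    have hxy := congrArg Subtype.val (Eq.trans hx (Eq.symm hy))
    obtain ⟨i, hi⟩ := hc x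
    have h1 : 0 < φ x i := lt_max_of_lt_right (by linarith)
    have h2 : φ x i / ∑ j, φ x j = φ y i / ∑ j, φ y j := congrFun hxy i
    have h3 : 0 < φ y i := by
      refine lt_of_le_of_ne (hφ y i) fun h0 => ?_
      rw [← h0, zero_div] at h2
      exact (div_pos h1 (hsum x)).ne' h2
    have h4 := h.triangle x (c i) y
    rw [h.symm x (c i)] at h4
    linarith [hφpos x i h1, hφpos y i h3]

/-- A space of width dimension `w` maps almost injectively to `ℝ^(2w+1)`. -/
theorem IsContPseudometric.exists_separating_map [CompactSpace Y] [Nonempty Y]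
    (h : IsContPseudometric ρ) (hδ : 0 < δ) :
    ∃ g : Y → Fin (2 * widim Y ρ δ + 1) → ℝ, Continuous g ∧
      ∀ y y', g y = g y' → ρ y y' < δ := by
  obtain ⟨m, K, hK1, hK2, f, hf, hfδ⟩ := Nat.sInf_mem (h.widim_set_nonempty hδ)
  obtain ⟨L, hL⟩ := exists_linearMap_injOn_space (w := widim Y ρ δ) K hK1 hK2
  refine ⟨fun y => L (f y), L.continuous_of_finiteDimensional.comp (continuous_subtype_val.comp hf),
    fun y y' hy => ?_⟩
  have h1 : f y = f y' := Subtype.ext (hL (f y).2 (f y').2 hy)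
  exact lt_of_setEDiam_lt (hfδ (f y')) h1 rfl

end Widim

section Limits

lemma mul_sub_le_log_of_frequently {M a K q : ℕ} {μ : ℝ} (hM : 0 < M) (hq : 0 < q) (w : ℕ → ℕ)
    (hw : ∃ᶠ N : ℕ in atTop, (w N : ℝ) ≤ μ * N)
    (h : ∀ N, q ^ (N / M * M * a) ≤ 16 ^ (2 * w N + 1) * 4 ^ (N / M * M * a) *
      (K ^ (N / M) * 2 ^ (N / M * M * a)) * q ^ (2 * w N + 1 + 1)) :
    M * (a * (Real.log q - Real.log 8) - 2 * μ * (Real.log 16 + Real.log q)) ≤ Real.log K := by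
  have hlq : 0 ≤ Real.log q := Real.log_natCast_nonneg q
  have hl16 : 0 < Real.log 16 := Real.log_pos (by norm_num)
  have hMr : (0 : ℝ) < M := by exact_mod_cast hM
  have hqr : (0 : ℝ) < q := by exact_mod_cast hq
  have hl8 : Real.log 8 = Real.log 4 + Real.log 2 := by
    rw [← Real.log_mul (by norm_num) (by norm_num)]
    norm_num
  by_contra! hlt
  obtain ⟨P, hP⟩ := exists_nat_gt ((2 * μ * M + 2) * (Real.log 16 + Real.log q) /
    (M * (a * (Real.log q - Real.log 8) - 2 * μ * (Real.log 16 + Real.log q)) - Real.log K))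
  rw [div_lt_iff₀ (by linarith)] at hP
  obtain ⟨N, hwN, hN⟩ := (hw.and_eventually (eventually_ge_atTop ((P + 1) * M))).exists
  have hp : P + 1 ≤ N / M := (Nat.le_div_iff_mul_le hM).2 hN
  have hNp : N ≤ (N / M + 1) * M := by
    rw [mul_comm]
    exact (Nat.lt_mul_div_succ N hM).le
  have hN0 : 0 < N := lt_of_lt_of_le (by positivity) hN
  have hμ : 0 ≤ μ := by
    by_contra! hμ
    have : (0 : ℝ) < N := by exact_mod_cast hN0
    have h2 : (0 : ℝ) ≤ w N := Nat.cast_nonneg _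
    nlinarith
  have hineq := h N
  generalize N / M = p at hp hNp hineq
  have hK : K ≠ 0 := by
    rintro rfl
    rw [zero_pow (by omega)] at hineq
    have : 0 < q ^ (p * M * a) := by positivity
    simp only [zero_mul, mul_zero] at hineq
    omega
  have hKr : (0 : ℝ) < K := by exact_mod_cast Nat.pos_of_ne_zero hK
  have hlog : Real.log ((q : ℝ) ^ (p * M * a)) ≤ Real.log ((16 : ℝ) ^ (2 * w N + 1) *
      4 ^ (p * M * a) * (K ^ p * 2 ^ (p * M * a)) * q ^ (2 * w N + 1 + 1)) :=
    Real.log_le_log (by positivity) (by exact_mod_cast hineq)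
  rw [Real.log_mul (by positivity) (by positivity), Real.log_mul (by positivity) (by positivity),
    Real.log_mul (by positivity) (by positivity), Real.log_mul (by positivity) (by positivity)]
    at hlog
  simp only [Real.log_pow] at hlog
  push_cast at hlog
  have hp' : (P : ℝ) ≤ p := by exact_mod_cast (by omega : P ≤ p)
  have hNp' : (N : ℝ) ≤ (p + 1) * M := by exact_mod_cast hNp
  have hw' : (w N : ℝ) ≤ μ * ((p + 1) * M) := hwN.trans (mul_le_mul_of_nonneg_left hNp' hμ)
  have hmain : (p : ℝ) * (M * (a * (Real.log q - Real.log 8) -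
      2 * μ * (Real.log 16 + Real.log q)) - Real.log K) ≤
      (2 * μ * M + 2) * (Real.log 16 + Real.log q) := by
    have h1 := mul_le_mul_of_nonneg_right hw' (by linarith : 0 ≤ 2 * (Real.log 16 + Real.log q))
    rw [hl8]
    nlinarith
  have := mul_le_mul_of_nonneg_right hp' (sub_nonneg.2 hlt.le)
  linarith

lemma mul_sub_le_supLogCov {a : ℕ} {Y : Type*} [MetricSpace Y] [CompactSpace Y] {S : Y → Y}
    (hS : Continuous S) {π : FullShift a → Y} (hπ : Continuous π)
    (hequiv : ∀ x, π (shift x) = S (π x)) {M q : ℕ} {ε μ : ℝ} (hM : 0 < M) (hq : 0 < q)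
    (hε : 0 < ε) (hqε : (q : ℝ) * ε ≤ 1)
    (hμ : ∀ᶠ δ in 𝓝[>] (0 : ℝ), ∃ᶠ N : ℕ in atTop, (widim Y (dynDist S dist N) δ : ℝ) ≤ μ * N) :
    M * (a * (Real.log q - Real.log 8) - 2 * μ * (Real.log 16 + Real.log q)) ≤
      supLogCov π (dynDist shift shiftDist M) ε := by
  have hY : Nonempty Y := ⟨π fun _ _ => 0⟩
  have hρ : IsContPseudometric (dynDist shift (shiftDist (a := a)) M) :=
    isContPseudometric_dynDist isContPseudometric_shiftDist continuous_shift M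
  obtain ⟨K, hK, hKlog⟩ := hρ.exists_covNum_fiber_le hε π
  refine le_trans ?_ hKlog
  obtain ⟨δ₀, hδ₀, hcov⟩ := exists_pos_forall_preimage_ball_subset hπ
    {V | ∃ U : Fin K → Set (FullShift a), (∀ i, IsOpen (U i)) ∧
      (∀ i, ∀ x ∈ U i, ∀ y ∈ U i, dynDist shift shiftDist M x y < ε) ∧ V = ⋃ i, U i}
    (by
      rintro _ ⟨U, hU, -, rfl⟩
      exact isOpen_iUnion hU)
    (fun x₀ => by
      obtain ⟨U, h1, h2, h3⟩ := hρ.exists_cover hε (hK (π x₀))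
      exact ⟨_, ⟨U, h1, h2, rfl⟩, fun x hx => h3 hx⟩)
  obtain ⟨δ, hδμ, hδ, hδle⟩ := (hμ.and (Ioc_mem_nhdsGT hδ₀)).exists
  refine mul_sub_le_log_of_frequently hM hq (fun N => widim Y (dynDist S dist N) δ) hδμ fun N => ?_
  obtain ⟨g, hg, hsep⟩ :=
    (isContPseudometric_dynDist isContPseudometric_dist hS N).exists_separating_map hδ
  refine pow_card_le_of_separating hπ hequiv hM (Nat.succ_pos _) hq hqε (fun x₀ => ?_) hg
    fun y y' hy n hn => (le_dynDist (hn.trans_le (Nat.div_mul_le_self N M)) y y').trans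
      ((hsep y y' hy).le.trans hδle)
  obtain ⟨_, ⟨U, h1, h2, rfl⟩, h3⟩ := hcov x₀
  exact ⟨U, h1, h2, h3⟩

lemma tendsto_log_floor_div_log :
    Tendsto (fun t : ℝ => Real.log ⌊t⌋₊ / Real.log t) atTop (𝓝 1) := by
  have h : Tendsto (fun t : ℝ => 1 - Real.log 2 / Real.log t) atTop (𝓝 (1 - 0)) :=
    tendsto_const_nhds.sub (Real.tendsto_log_atTop.const_div_atTop _)
  rw [sub_zero] at h
  refine tendsto_of_tendsto_of_tendsto_of_le_of_le' h tendsto_const_nhds ?_ ?_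
  · filter_upwards [eventually_ge_atTop 2] with t ht
    have hl : 0 < Real.log t := Real.log_pos (by linarith)
    have h1 : t / 2 ≤ ⌊t⌋₊ := by linarith [Nat.lt_floor_add_one t]
    rw [one_sub_div hl.ne', ← Real.log_div (by positivity) (by norm_num)]
    exact div_le_div_of_nonneg_right (Real.log_le_log (by positivity) h1) hl.le
  · filter_upwards [eventually_ge_atTop 2] with t ht
    have hl : 0 < Real.log t := Real.log_pos (by linarith)
    have h1 : (0 : ℝ) < ⌊t⌋₊ := by exact_mod_cast Nat.floor_pos.2 (by linarith)
    rw [div_le_one hl]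
    exact Real.log_le_log h1 (Nat.floor_le (by linarith))

lemma sub_le_lowerCondMdimM {a : ℕ} {Y : Type*} [MetricSpace Y] [CompactSpace Y] {S : Y → Y}
    (hS : Continuous S) {π : FullShift a → Y} (hπ : Continuous π)
    (hequiv : ∀ x, π (shift x) = S (π x)) {μ : ℝ}
    (hμ : ∀ᶠ δ in 𝓝[>] (0 : ℝ), ∃ᶠ N : ℕ in atTop, (widim Y (dynDist S dist N) δ : ℝ) ≤ μ * N) :
    ((a - 2 * μ : ℝ) : EReal) ≤ lowerCondMdimM π shift shiftDist := by
  set F : ℝ → ℝ := fun t => (a * (Real.log ⌊t⌋₊ - Real.log 8) -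
    2 * μ * (Real.log 16 + Real.log ⌊t⌋₊)) / Real.log t with hF
  have hlim : Tendsto F atTop (𝓝 (a - 2 * μ)) := by
    have h := (tendsto_log_floor_div_log.const_mul (a - 2 * μ)).sub
      (Real.tendsto_log_atTop.const_div_atTop (a * Real.log 8 + 2 * μ * Real.log 16))
    rw [mul_one, sub_zero] at h
    refine h.congr fun t => ?_
    simp only [hF]
    ring
  have hlim' : Tendsto (fun ε : ℝ => ((F (1 / ε) : ℝ) : EReal)) (𝓝[>] 0) (𝓝 (a - 2 * μ : ℝ)) := by
    refine (continuous_coe_real_ereal.tendsto _).comp (hlim.comp ?_)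
    exact tendsto_inv_nhdsGT_zero.congr fun x => (one_div x).symm
  rw [← hlim'.liminf_eq]
  refine liminf_le_liminf ?_
  filter_upwards [Ioo_mem_nhdsGT (zero_lt_one (α := ℝ))] with ε hε
  have hinv : 1 < 1 / ε := (one_lt_div hε.1).2 hε.2
  refine le_liminf_of_le (by isBoundedDefault) ?_
  filter_upwards [eventually_gt_atTop 0] with M hM
  have hMr : (0 : ℝ) < M := by exact_mod_cast hM
  rw [EReal.coe_le_coe_iff]
  simp only [hF]
  rw [div_le_div_iff₀ (Real.log_pos hinv) (mul_pos hMr (Real.log_pos hinv))]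
  have h := mul_sub_le_supLogCov hS hπ hequiv hM (Nat.floor_pos.2 hinv.le) hε.1
    ((mul_le_mul_of_nonneg_right (Nat.floor_le (by linarith)) hε.1.le).trans_eq
      (one_div_mul_cancel hε.1.ne')) hμ
  have h' := mul_le_mul_of_nonneg_right h (Real.log_pos hinv).le
  linarith

lemma eventually_frequently_widim_le {Y : Type*} [TopologicalSpace Y] {S : Y → Y}
    {d : Y → Y → ℝ} {μ : ℝ} (h : mdim Y S d < μ) :
    ∀ᶠ δ in 𝓝[>] (0 : ℝ), ∃ᶠ N : ℕ in atTop, (widim Y (dynDist S d N) δ : ℝ) ≤ μ * N := by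
  filter_upwards [eventually_lt_of_limsup_lt h] with δ hδ
  refine ((frequently_lt_of_liminf_lt (by isBoundedDefault) hδ).and_eventually
    (eventually_gt_atTop 0)).mono fun N hN => ?_
  have hN' : (0 : ℝ) < N := by exact_mod_cast hN.2
  exact ((div_lt_iff₀ hN').1 (EReal.coe_lt_coe_iff.1 hN.1)).le

lemma EReal.coe_sub_two_mul_le {c : ℝ} {m L : EReal}
    (h : ∀ μ : ℝ, m < μ → ((c - 2 * μ : ℝ) : EReal) ≤ L) : (c : EReal) - 2 * m ≤ L := by
  induction m with
  | top => simp [EReal.mul_top_of_pos]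
  | bot =>
    suffices L = ⊤ by simp [this]
    refine EReal.eq_top_iff_forall_lt L |>.2 fun y => ?_
    refine lt_of_lt_of_le ?_ (h ((c - y - 1) / 2) (EReal.bot_lt_coe _))
    rw [EReal.coe_lt_coe_iff]
    linarith
  | coe r =>
    refine EReal.ge_of_forall_gt_iff_ge.1 fun z hz => ?_
    have hcr : (c : EReal) - 2 * r = ((c - 2 * r : ℝ) : EReal) := by
      rw [EReal.coe_sub, EReal.coe_mul]
      rfl
    rw [hcr, EReal.coe_lt_coe_iff] at hz
    have h1 := h ((c - z) / 2) (EReal.coe_lt_coe_iff.2 (by linarith))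
    rwa [mul_div_cancel₀ _ two_ne_zero, sub_sub_cancel] at h1

end Limits

/-- For any dynamical system `(Y, S)` and any equivariant continuous map
`π : (([0,1]^a)^ℤ, σ) → (Y, S)` one has
`lower-mdim_M(π, σ, D) ≥ a − 2·mdim(Y, S)`. -/
theorem stmt_4 (a : ℕ) (Y : Type) [MetricSpace Y] [CompactSpace Y] (S : Y ≃ₜ Y)
    (π : FullShift a → Y) (hcont : Continuous π)
    (hequiv : ∀ x, π (shift x) = S (π x)) :
    ((a : ℝ) : EReal) - 2 * mdim Y (⇑S) dist ≤ lowerCondMdimM π shift shiftDist := by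
  exact EReal.coe_sub_two_mul_le fun _ hμ =>
    sub_le_lowerCondMdimM S.continuous hcont hequiv (eventually_frequently_widim_le hμ)
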